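/- arXiv:2210.16456 — 15 statements merged into one kernel-verified Lean document; each statement's English description precedes it below -/
import Mathlib

section
/- Let n ≥ 1, let K be an n×n real matrix with all entries strictly positive, and let μ, ν ∈ Δ_n have all entries strictly positive. Then there exist vectors u, v ∈ ℝ^n with all entries strictly positive such that the matrix P with entries P_ij = u_i K_ij v_j satisfies Σ_j P_ij = μ_i for all i and Σ_i P_ij = ν_j for all j (existence of a Matrix Scaling; i.e., P = XKY for positive diagonal matrices X = diag(u), Y = diag(v) with row marginals μ and column marginals ν). -/
/-- The log-potential whose critical points in the positive orthant are matrix scalings. -/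
noncomputable def scalingPotential {ι : Type*} [Fintype ι] (K : Matrix ι ι ℝ) (μ ν v : ι → ℝ) : ℝ :=
  ∑ j, ν j * Real.log (v j) - ∑ i, μ i * Real.log (∑ j, K i j * v j)

/-- The scaling potential is invariant under positive dilations. -/
theorem scalingPotential_smul {ι : Type*} [Fintype ι] [Nonempty ι] {K : Matrix ι ι ℝ}
    (hK : ∀ i j, 0 < K i j) {μ ν v : ι → ℝ} (hμ : ∑ i, μ i = 1) (hν : ∑ j, ν j = 1)
    (hv : ∀ j, 0 < v j) {c : ℝ} (hc : 0 < c) :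
    scalingPotential K μ ν (c • v) = scalingPotential K μ ν v := by
  have hKv : ∀ i, 0 < ∑ j, K i j * v j := fun i =>
    Finset.sum_pos (fun j _ => mul_pos (hK i j) (hv j)) Finset.univ_nonempty
  have h1 : ∀ j, ν j * Real.log ((c • v) j) = ν j * Real.log c + ν j * Real.log (v j) := by
    intro j
    rw [Pi.smul_apply, smul_eq_mul, Real.log_mul hc.ne' (hv j).ne', mul_add]
  have h2 : ∀ i, μ i * Real.log (∑ j, K i j * (c • v) j) =
      μ i * Real.log c + μ i * Real.log (∑ j, K i j * v j) := by
    intro i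
    have : ∑ j, K i j * (c • v) j = c * ∑ j, K i j * v j := by
      rw [Finset.mul_sum]
      exact Finset.sum_congr rfl fun j _ => by simp only [Pi.smul_apply, smul_eq_mul]; ring
    rw [this, Real.log_mul hc.ne' (hKv i).ne', mul_add]
  unfold scalingPotential
  simp only [h1, h2, Finset.sum_add_distrib, ← Finset.sum_mul, hμ, hν]
  ring

/-- The scaling potential attains its maximum over the open probability simplex. -/
theorem exists_max_scalingPotential_stdSimplex {ι : Type*} [Fintype ι] [Nonempty ι]
    {K : Matrix ι ι ℝ} (hK : ∀ i j, 0 < K i j) {μ ν : ι → ℝ} (hν : ∀ j, 0 < ν j) :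
    ∃ v : ι → ℝ, (∀ j, 0 < v j) ∧ ∀ w ∈ stdSimplex ℝ ι, (∀ j, 0 < w j) →
      scalingPotential K μ ν w ≤ scalingPotential K μ ν v := by
  let G : (ι → ℝ) → ℝ := fun v => (∏ j, v j ^ ν j) * ∏ i, (∑ j, K i j * v j) ^ (-μ i)
  have hKv : ∀ v ∈ stdSimplex ℝ ι, ∀ i, 0 < ∑ j, K i j * v j := by
    intro v hv i
    refine Finset.sum_pos' (fun j _ => mul_nonneg (hK i j).le (hv.1 j)) ?_
    by_contra! h
    have h0 : ∀ j, v j ≤ 0 := fun j => by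
      by_contra! hj
      exact absurd (mul_pos (hK i j) hj) (not_lt.2 (h j (Finset.mem_univ j)))
    have := Finset.sum_nonpos fun j (_ : j ∈ Finset.univ) => h0 j
    linarith [hv.2]
  have hG : ContinuousOn G (stdSimplex ℝ ι) := by
    refine ContinuousOn.mul ?_ ?_
    · refine continuousOn_finsetProd _ fun j _ => ?_
      exact (continuous_apply j).continuousOn.rpow_const fun v _ => Or.inr (hν j).le
    · refine continuousOn_finsetProd _ fun i _ => ?_
      refine ContinuousOn.rpow_const (by fun_prop) fun v hv => Or.inl (hKv v hv i).ne'
  have hGexp : ∀ w ∈ stdSimplex ℝ ι, (∀ j, 0 < w j) →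
      G w = Real.exp (scalingPotential K μ ν w) := by
    intro w hw hpos
    have h1 : ∀ j, w j ^ ν j = Real.exp (ν j * Real.log (w j)) := fun j => by
      rw [Real.rpow_def_of_pos (hpos j), mul_comm]
    have h2 : ∀ i, (∑ j, K i j * w j) ^ (-μ i) =
        Real.exp (-(μ i * Real.log (∑ j, K i j * w j))) := fun i => by
      rw [Real.rpow_def_of_pos (hKv w hw i)]
      ring_nf
    simp only [G, h1, h2, ← Real.exp_sum, ← Real.exp_add, scalingPotential,
      Finset.sum_neg_distrib, sub_eq_add_neg]
  have hcard : (0 : ℝ) < Fintype.card ι := by exact_mod_cast Fintype.card_pos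
  have hbpos : ∀ j : ι, 0 < (fun _ : ι => (Fintype.card ι : ℝ)⁻¹) j := fun _ => inv_pos.2 hcard
  have hb : (fun _ : ι => (Fintype.card ι : ℝ)⁻¹) ∈ stdSimplex ℝ ι :=
    ⟨fun j => (hbpos j).le, by simp [hcard.ne']⟩
  obtain ⟨v, hv, hmax⟩ := (isCompact_stdSimplex ℝ ι).exists_isMaxOn ⟨_, hb⟩ hG
  have hGv : 0 < G v := lt_of_lt_of_le (by rw [hGexp _ hb hbpos]; exact Real.exp_pos _) (hmax hb)
  have hvpos : ∀ j, 0 < v j := by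
    intro j
    refine lt_of_le_of_ne (hv.1 j) fun h => hGv.ne' ?_
    have : ∏ j, v j ^ ν j = 0 := Finset.prod_eq_zero (Finset.mem_univ j) (by
      rw [← h, Real.zero_rpow (hν j).ne'])
    simp only [G, this, zero_mul]
  refine ⟨v, hvpos, fun w hw hwpos => ?_⟩
  have : G w ≤ G v := hmax hw
  rwa [hGexp w hw hwpos, hGexp v hv hvpos, Real.exp_le_exp] at this

/-- The derivative of the scaling potential along a coordinate direction. -/
theorem hasDerivAt_scalingPotential_single {ι : Type*} [Fintype ι] [DecidableEq ι] [Nonempty ι]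
    {K : Matrix ι ι ℝ} (hK : ∀ i j, 0 < K i j) (μ ν : ι → ℝ) {v : ι → ℝ} (hv : ∀ j, 0 < v j)
    (k : ι) :
    HasDerivAt (fun t : ℝ => scalingPotential K μ ν (v + t • Pi.single k 1))
      (ν k / v k - ∑ i, μ i * (K i k / ∑ j, K i j * v j)) 0 := by
  have hKv : ∀ i, 0 < ∑ j, K i j * v j := fun i =>
    Finset.sum_pos (fun j _ => mul_pos (hK i j) (hv j)) Finset.univ_nonempty
  have hcoord : ∀ j, HasDerivAt (fun t : ℝ => (v + t • (Pi.single k 1 : ι → ℝ)) j)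
      ((Pi.single k 1 : ι → ℝ) j) 0 := by
    intro j
    simpa using ((hasDerivAt_id (0 : ℝ)).mul_const ((Pi.single k 1 : ι → ℝ) j)).const_add (v j)
  have h1 : HasDerivAt (fun t : ℝ => ∑ j, ν j * Real.log ((v + t • (Pi.single k 1 : ι → ℝ)) j))
      (∑ j, ν j * ((Pi.single k 1 : ι → ℝ) j / v j)) 0 := by
    refine HasDerivAt.fun_sum fun j _ => ?_
    simpa using ((hcoord j).log (by simpa using (hv j).ne')).const_mul (ν j)
  have h2 : HasDerivAt
      (fun t : ℝ => ∑ i, μ i * Real.log (∑ j, K i j * (v + t • (Pi.single k 1 : ι → ℝ)) j))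
      (∑ i, μ i * ((∑ j, K i j * (Pi.single k 1 : ι → ℝ) j) / ∑ j, K i j * v j)) 0 := by
    refine HasDerivAt.fun_sum fun i _ => ?_
    have h : HasDerivAt (fun t : ℝ => ∑ j, K i j * (v + t • (Pi.single k 1 : ι → ℝ)) j)
        (∑ j, K i j * (Pi.single k 1 : ι → ℝ) j) 0 :=
      HasDerivAt.fun_sum fun j _ => (hcoord j).const_mul (K i j)
    have h' := (h.log (by simpa using (hKv i).ne')).const_mul (μ i)
    simpa only [zero_smul, add_zero] using h'
  refine (h1.sub h2).congr_deriv ?_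
  congr 1
  · rw [Finset.sum_eq_single k (fun j _ hj => by simp [hj]) (by simp)]
    simp [div_eq_mul_inv]
  · simp [Pi.single_apply]

/-- **Existence of a Matrix Scaling.** For any entrywise positive `n × n` matrix `K` and
strictly positive probability vectors `μ, ν ∈ Δ_n`, there exist strictly positive vectors
`u, v` such that `P i j = u i * K i j * v j` has row sums `μ` and column sums `ν`. -/
theorem matrix_scaling_exists
    (n : ℕ) (hn : 1 ≤ n) (K : Matrix (Fin n) (Fin n) ℝ)
    (hK : ∀ i j, 0 < K i j)
    (μ ν : Fin n → ℝ)
    (hμpos : ∀ i, 0 < μ i) (hμsum : ∑ i, μ i = 1)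
    (hνpos : ∀ j, 0 < ν j) (hνsum : ∑ j, ν j = 1) :
    ∃ u v : Fin n → ℝ, (∀ i, 0 < u i) ∧ (∀ j, 0 < v j) ∧
      (∀ i, ∑ j, u i * K i j * v j = μ i) ∧
      (∀ j, ∑ i, u i * K i j * v j = ν j) := by
  have : Nonempty (Fin n) := ⟨⟨0, hn⟩⟩
  obtain ⟨v, hv, hmax⟩ := exists_max_scalingPotential_stdSimplex (μ := μ) hK hνpos
  have hKv : ∀ i, 0 < ∑ j, K i j * v j := fun i =>
    Finset.sum_pos (fun j _ => mul_pos (hK i j) (hv j)) Finset.univ_nonempty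
  have hmax_pos : ∀ w : Fin n → ℝ, (∀ j, 0 < w j) →
      scalingPotential K μ ν w ≤ scalingPotential K μ ν v := by
    intro w hw
    have hs : 0 < ∑ j, w j := Finset.sum_pos (fun j _ => hw j) Finset.univ_nonempty
    rw [← scalingPotential_smul hK hμsum hνsum hw (inv_pos.2 hs)]
    have hpos : ∀ j, 0 < ((∑ j, w j)⁻¹ • w) j := fun j => mul_pos (inv_pos.2 hs) (hw j)
    refine hmax _ ⟨fun j => (hpos j).le, ?_⟩ hpos
    simp only [Pi.smul_apply, smul_eq_mul, ← Finset.mul_sum]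
    exact inv_mul_cancel₀ hs.ne'
  have hcrit : ∀ k, ν k / v k = ∑ i, μ i * (K i k / ∑ j, K i j * v j) := by
    intro k
    refine sub_eq_zero.1 (IsLocalMax.hasDerivAt_eq_zero ?_
      (hasDerivAt_scalingPotential_single hK μ ν hv k))
    filter_upwards [lt_mem_nhds (neg_lt_zero.2 (hv k))] with t ht
    rw [zero_smul, add_zero]
    refine hmax_pos _ fun j => ?_
    by_cases hj : j = k
    · subst hj
      simp only [Pi.add_apply, Pi.smul_apply, Pi.single_eq_same, smul_eq_mul, mul_one]
      linarith
    · simpa [hj] using hv j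
  refine ⟨fun i => μ i / ∑ j, K i j * v j, v, fun i => div_pos (hμpos i) (hKv i), hv,
    fun i => ?_, fun k => ?_⟩
  · simp only [mul_assoc, ← Finset.mul_sum]
    exact div_mul_cancel₀ _ (hKv i).ne'
  · rw [← Finset.sum_mul, ← div_mul_cancel₀ (ν k) (hv k).ne', hcrit k]
    congr 1
    exact Finset.sum_congr rfl fun i _ => by ring
end

section
/- Let n ≥ 1, let K be an n×n real matrix with all entries strictly positive, and let μ, ν ∈ Δ_n have all entries strictly positive. If u, v ∈ ℝ^n and u', v' ∈ ℝ^n are strictly positive vectors such that both matrices P_ij = u_i K_ij v_j and P'_ij = u'_i K_ij v'_j have row sums μ and column sums ν, then there exists a constant c > 0 with u' = c·u and v' = c^{-1}·v; in particular P = P', i.e., the scaled matrix solving the Matrix Scaling problem is unique. -/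
/-- If a positive matrix `P` and its rescaling `a i * P i j * b j` have the same row and column
sums, then all products `a i * b j` equal one. -/
lemma mul_eq_one_of_rescaling_same_marginals {ι κ : Type*} [Fintype ι] [Fintype κ]
    [Nonempty ι] [Nonempty κ] (P : ι → κ → ℝ) (hP : ∀ i j, 0 < P i j)
    (a : ι → ℝ) (b : κ → ℝ) (ha : ∀ i, 0 < a i) (hb : ∀ j, 0 < b j)
    (hrow : ∀ i, ∑ j, P i j * (a i * b j - 1) = 0)
    (hcol : ∀ j, ∑ i, P i j * (a i * b j - 1) = 0) (i : ι) (j : κ) :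
    a i * b j = 1 := by
  obtain ⟨p, hp⟩ := Finite.exists_max a
  obtain ⟨q, hq⟩ := Finite.exists_min b
  have hpq : 1 ≤ a p * b q := by
    by_contra! hlt
    have hneg : ∑ i, P i q * (a i * b q - 1) < 0 := by
      refine Finset.sum_neg (fun i _ => mul_neg_of_pos_of_neg (hP i q) ?_)
        Finset.univ_nonempty
      linarith [mul_le_mul_of_nonneg_right (hp i) (hb q).le]
    exact hneg.ne (hcol q)
  have hpb (j : κ) : a p * b j = 1 := by
    have hnonneg : ∀ j ∈ Finset.univ, 0 ≤ P p j * (a p * b j - 1) := fun j _ =>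
      mul_nonneg (hP p j).le
        (by linarith [mul_le_mul_of_nonneg_left (hq j) (ha p).le])
    have hzero := (Finset.sum_eq_zero_iff_of_nonneg hnonneg).1 (hrow p) j (Finset.mem_univ j)
    linarith [(mul_eq_zero.1 hzero).resolve_left (hP p j).ne']
  have hnonpos : ∀ i ∈ Finset.univ, P i j * (a i * b j - 1) ≤ 0 := fun i _ =>
    mul_nonpos_of_nonneg_of_nonpos (hP i j).le
      (by linarith [mul_le_mul_of_nonneg_right (hp i) (hb j).le, hpb j])
  have hzero := (Finset.sum_eq_zero_iff_of_nonpos hnonpos).1 (hcol j) i (Finset.mem_univ i)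
  linarith [(mul_eq_zero.1 hzero).resolve_left (hP i j).ne']

/-- **Uniqueness of Matrix Scaling.** If two pairs of strictly positive scaling vectors
`(u, v)` and `(u', v')` both scale the entrywise positive matrix `K` to have row sums `μ`
and column sums `ν`, then `u' = c • u` and `v' = c⁻¹ • v` for some constant `c > 0`;
in particular the scaled matrices coincide. -/
theorem matrix_scaling_unique
    (n : ℕ) (hn : 1 ≤ n) (K : Matrix (Fin n) (Fin n) ℝ)
    (hK : ∀ i j, 0 < K i j)
    (μ ν : Fin n → ℝ)
    (hμpos : ∀ i, 0 < μ i) (hμsum : ∑ i, μ i = 1)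
    (hνpos : ∀ j, 0 < ν j) (hνsum : ∑ j, ν j = 1)
    (u v u' v' : Fin n → ℝ)
    (hu : ∀ i, 0 < u i) (hv : ∀ j, 0 < v j)
    (hu' : ∀ i, 0 < u' i) (hv' : ∀ j, 0 < v' j)
    (hrow : ∀ i, ∑ j, u i * K i j * v j = μ i)
    (hcol : ∀ j, ∑ i, u i * K i j * v j = ν j)
    (hrow' : ∀ i, ∑ j, u' i * K i j * v' j = μ i)
    (hcol' : ∀ j, ∑ i, u' i * K i j * v' j = ν j) :
    (∃ c : ℝ, 0 < c ∧ (∀ i, u' i = c * u i) ∧ (∀ j, v' j = c⁻¹ * v j)) ∧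
      (∀ i j, u' i * K i j * v' j = u i * K i j * v j) := by
  have : Nonempty (Fin n) := ⟨⟨0, hn⟩⟩
  have hterm (i j : Fin n) : u i * K i j * v j * (u' i / u i * (v' j / v j) - 1) =
      u' i * K i j * v' j - u i * K i j * v j := by
    have := (hu i).ne'
    have := (hv j).ne'
    field_simp
  have hab := mul_eq_one_of_rescaling_same_marginals (fun i j => u i * K i j * v j)
    (fun i j => mul_pos (mul_pos (hu i) (hK i j)) (hv j))
    (fun i => u' i / u i) (fun j => v' j / v j)
    (fun i => div_pos (hu' i) (hu i)) (fun j => div_pos (hv' j) (hv j))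
    (fun i => by simp only [hterm, Finset.sum_sub_distrib, hrow, hrow', sub_self])
    (fun j => by simp only [hterm, Finset.sum_sub_distrib, hcol, hcol', sub_self])
  let k : Fin n := ⟨0, hn⟩
  have hc : 0 < u' k / u k := div_pos (hu' k) (hu k)
  refine ⟨⟨u' k / u k, hc, fun i => ?_, fun j => ?_⟩, fun i j => ?_⟩
  · rw [← div_eq_iff (hu i).ne']
    exact mul_right_cancel₀ (div_pos (hv' k) (hv k)).ne' ((hab i k).trans (hab k k).symm)
  · rw [← div_eq_iff (hv j).ne']
    exact eq_inv_of_mul_eq_one_right (hab k j)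
  · have h := hterm i j
    rw [hab i j, sub_self, mul_zero] at h
    exact sub_eq_zero.1 h.symm
end

section
/- Let n ≥ 1 and let K be an n×n real matrix with all entries strictly positive. Then there exists a vector d ∈ ℝ^n with all entries strictly positive such that the matrix P with entries P_ij = d_i K_ij / d_j satisfies Σ_j P_ij = Σ_j P_ji for every i (existence of a Matrix Balancing, i.e., P = XKX^{-1} with X = diag(d) has symmetric marginals P1 = P^T1). Moreover, d is unique up to multiplication by a positive scalar, so the balanced matrix P is unique. -/
open Finset in
/-- The exponential-sum functional attached to an entrywise positive matrix attains its minimum: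
it is invariant under translation along `1` and its sublevel sets are bounded modulo `1`. -/
theorem exists_forall_sum_mul_exp_sub_le {ι : Type*} [Fintype ι] [Nonempty ι]
    (K : Matrix ι ι ℝ) (hK : ∀ i j, 0 < K i j) :
    ∃ x : ι → ℝ, ∀ y : ι → ℝ,
      ∑ i, ∑ j, K i j * Real.exp (x i - x j) ≤ ∑ i, ∑ j, K i j * Real.exp (y i - y j) := by
  obtain ⟨o⟩ := ‹Nonempty ι›
  set F : (ι → ℝ) → ℝ := fun x => ∑ i, ∑ j, K i j * Real.exp (x i - x j) with hF
  set L : ℝ := ∑ i, ∑ j, |Real.log (F 0 / K i j)|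
  have hL : ∀ i j, Real.log (F 0 / K i j) ≤ L := fun i j =>
    calc Real.log (F 0 / K i j) ≤ |Real.log (F 0 / K i j)| := le_abs_self _
      _ ≤ ∑ j, |Real.log (F 0 / K i j)| :=
        single_le_sum (f := fun j => |Real.log (F 0 / K i j)|)
          (fun _ _ => abs_nonneg _) (mem_univ j)
      _ ≤ L := single_le_sum (f := fun i => ∑ j, |Real.log (F 0 / K i j)|)
          (fun _ _ => sum_nonneg fun _ _ => abs_nonneg _) (mem_univ i)
  have hL0 : 0 ≤ L := sum_nonneg fun _ _ => sum_nonneg fun _ _ => abs_nonneg _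
  have hpos : ∀ (y : ι → ℝ) i j, 0 < K i j * Real.exp (y i - y j) := fun y i j =>
    mul_pos (hK i j) (Real.exp_pos _)
  have hentry : ∀ (y : ι → ℝ) i j, K i j * Real.exp (y i - y j) ≤ F y := fun y i j =>
    calc K i j * Real.exp (y i - y j) ≤ ∑ j, K i j * Real.exp (y i - y j) :=
        single_le_sum (f := fun j => K i j * Real.exp (y i - y j))
          (fun _ _ => (hpos y _ _).le) (mem_univ j)
      _ ≤ F y := single_le_sum (f := fun i => ∑ j, K i j * Real.exp (y i - y j))
          (fun _ _ => sum_nonneg fun _ _ => (hpos y _ _).le) (mem_univ i)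
  have hdiff : ∀ y : ι → ℝ, F y ≤ F 0 → ∀ i j, y i - y j ≤ L := fun y hy i j => by
    refine le_trans ?_ (hL i j)
    have h := (hentry y i j).trans hy
    rw [Real.le_log_iff_exp_le (div_pos ((hpos y i j).trans_le h) (hK i j)),
      le_div_iff₀ (hK i j)]
    linarith
  have hcont : Continuous F := by fun_prop
  have hmem0 : (0 : ι → ℝ) ∈ Set.Icc (fun _ => -L) (fun _ : ι => L) :=
    ⟨fun _ => neg_nonpos.2 hL0, fun _ => hL0⟩
  obtain ⟨x, -, hx⟩ := isCompact_Icc.exists_isMinOn ⟨0, hmem0⟩ hcont.continuousOn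
  refine ⟨x, fun y => ?_⟩
  rcases le_total (F y) (F 0) with hy | hy
  · have hshift : F (fun i => y i - y o) = F y := by simp [hF]
    have hmem : (fun i => y i - y o) ∈ Set.Icc (fun _ => -L) (fun _ : ι => L) :=
      ⟨fun i => by have := hdiff y hy o i; simp only; linarith, fun i => hdiff y hy i o⟩
    exact (hx hmem).trans_eq hshift
  · exact (hx hmem0).trans hy

/-- At a minimizer of the exponential-sum functional the scaled matrix has symmetric marginals. -/
theorem sum_mul_exp_sub_eq_of_forall_le {ι : Type*} [Fintype ι]
    (K : Matrix ι ι ℝ) (x : ι → ℝ)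
    (hx : ∀ y : ι → ℝ,
      ∑ i, ∑ j, K i j * Real.exp (x i - x j) ≤ ∑ i, ∑ j, K i j * Real.exp (y i - y j)) (k : ι) :
    ∑ j, K k j * Real.exp (x k - x j) = ∑ j, K j k * Real.exp (x j - x k) := by
  classical
  set e : ι → ℝ := Pi.single k 1 with he
  have hderiv : HasDerivAt
      (fun t : ℝ => ∑ i, ∑ j, K i j * Real.exp ((x i + t * e i) - (x j + t * e j)))
      (∑ i, ∑ j, K i j * (Real.exp ((x i + 0 * e i) - (x j + 0 * e j)) * (1 * e i - 1 * e j)))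
      0 := by
    refine HasDerivAt.fun_sum fun i _ => HasDerivAt.fun_sum fun j _ => ?_
    exact ((((hasDerivAt_id (0 : ℝ)).mul_const (e i)).const_add (x i)).sub
      (((hasDerivAt_id (0 : ℝ)).mul_const (e j)).const_add (x j))).exp.const_mul (K i j)
  have hmin : IsLocalMin
      (fun t : ℝ => ∑ i, ∑ j, K i j * Real.exp ((x i + t * e i) - (x j + t * e j))) 0 :=
    Filter.Eventually.of_forall fun t => by simpa using hx fun i => x i + t * e i
  have h := hmin.hasDerivAt_eq_zero hderiv
  simp only [zero_mul, add_zero, one_mul, mul_sub, Finset.sum_sub_distrib] at h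
  rw [sub_eq_zero, Finset.sum_comm (f := fun i j => K i j * (Real.exp (x i - x j) * e j))] at h
  simpa [he, Pi.single_apply] using h

/-- Two positive vectors balancing the same positive matrix are proportional. -/
theorem exists_pos_eq_mul_of_balanced {ι : Type*} [Fintype ι] [Nonempty ι]
    (K : Matrix ι ι ℝ) (hK : ∀ i j, 0 < K i j) (d d' : ι → ℝ)
    (hd : ∀ i, 0 < d i) (hd' : ∀ i, 0 < d' i)
    (h : ∀ i, ∑ j, d i * K i j / d j = ∑ j, d j * K j i / d i)
    (h' : ∀ i, ∑ j, d' i * K i j / d' j = ∑ j, d' j * K j i / d' i) :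
    ∃ c : ℝ, 0 < c ∧ ∀ i, d' i = c * d i := by
  obtain ⟨i, hi⟩ := Finite.exists_max fun i => d' i / d i
  have hmax : ∀ j, d' j * d i ≤ d' i * d j := fun j =>
    (div_le_div_iff₀ (hd j) (hd i)).1 (hi j)
  have hrow : ∑ j, d i * K i j / d j ≤ ∑ j, d' i * K i j / d' j :=
    Finset.sum_le_sum fun j _ => by
      rw [div_le_div_iff₀ (hd j) (hd' j)]
      nlinarith [mul_le_mul_of_nonneg_left (hmax j) (hK i j).le]
  have hcol : ∀ j ∈ Finset.univ, d' j * K j i / d' i ≤ d j * K j i / d i := fun j _ => by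
    rw [div_le_div_iff₀ (hd' i) (hd i)]
    nlinarith [mul_le_mul_of_nonneg_left (hmax j) (hK j i).le]
  have heq := (Finset.sum_eq_sum_iff_of_le hcol).1
    (le_antisymm (Finset.sum_le_sum hcol) (by rw [← h, ← h']; exact hrow))
  refine ⟨d' i / d i, div_pos (hd' i) (hd i), fun j => ?_⟩
  have hj := heq j (Finset.mem_univ j)
  rw [div_eq_div_iff (hd' i).ne' (hd i).ne'] at hj
  rw [div_mul_eq_mul_div, eq_div_iff (hd i).ne']
  exact mul_right_cancel₀ (hK j i).ne' (by linarith)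

/-- **Existence and uniqueness of Matrix Balancing.** For any entrywise positive `n × n`
matrix `K` there exists a strictly positive vector `d` such that
`P i j = d i * K i j / d j` has equal row and column sums (`P 1 = Pᵀ 1`), and `d` is
unique up to multiplication by a positive scalar (so the balanced matrix `P` is unique). -/
theorem matrix_balancing_exists_unique
    (n : ℕ) (hn : 1 ≤ n) (K : Matrix (Fin n) (Fin n) ℝ)
    (hK : ∀ i j, 0 < K i j) :
    ∃ d : Fin n → ℝ, (∀ i, 0 < d i) ∧
      (∀ i, ∑ j, d i * K i j / d j = ∑ j, d j * K j i / d i) ∧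
      (∀ d' : Fin n → ℝ, (∀ i, 0 < d' i) →
        (∀ i, ∑ j, d' i * K i j / d' j = ∑ j, d' j * K j i / d' i) →
        (∃ c : ℝ, 0 < c ∧ ∀ i, d' i = c * d i) ∧
          (∀ i j, d' i * K i j / d' j = d i * K i j / d j)) := by
  have : Nonempty (Fin n) := ⟨⟨0, hn⟩⟩
  obtain ⟨x, hx⟩ := exists_forall_sum_mul_exp_sub_le K hK
  have hexp : ∀ i j, Real.exp (x i) * K i j / Real.exp (x j) = K i j * Real.exp (x i - x j) :=
    fun i j => by rw [Real.exp_sub]; ring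
  have hbal : ∀ i, ∑ j, Real.exp (x i) * K i j / Real.exp (x j) =
      ∑ j, Real.exp (x j) * K j i / Real.exp (x i) := fun i => by
    simpa only [hexp] using sum_mul_exp_sub_eq_of_forall_le K x hx i
  refine ⟨fun i => Real.exp (x i), fun i => Real.exp_pos _, hbal, fun d' hd' h' => ?_⟩
  obtain ⟨c, hc, hcd⟩ := exists_pos_eq_mul_of_balanced K hK (fun i => Real.exp (x i)) d'
    (fun i => Real.exp_pos _) hd' hbal h'
  refine ⟨⟨c, hc, hcd⟩, fun i j => ?_⟩
  rw [hcd i, hcd j, mul_assoc, mul_div_mul_left _ _ hc.ne']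
end

section
/- Let n ≥ 1, η > 0, C ∈ ℝ^{n×n}, and let μ, ν ∈ Δ_n have all entries strictly positive. Then the entropically regularized Optimal Transport problem min over P ∈ U(μ,ν) of Σ_{ij} C_ij P_ij + η^{-1} Σ_{ij} P_ij log P_ij has a unique minimizer P*. Moreover, P* is characterized as the unique element of U(μ,ν) of the form P*_ij = u_i e^{-η C_ij} v_j for some strictly positive vectors u, v ∈ ℝ^n; that is, P* is the solution to the Matrix Scaling problem for the matrix K = exp[-ηC] (entrywise exponential) with target marginals μ and ν. -/
/-- The transportation polytope `U(μ, ν)`: joint distributions with marginals `μ` and `ν`. -/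
def transportPolytope (n : ℕ) (μ ν : Fin n → ℝ) : Set (Matrix (Fin n) (Fin n) ℝ) :=
  {P | (∀ i j, 0 ≤ P i j) ∧ (∑ i, ∑ j, P i j) = 1 ∧
       (∀ i, ∑ j, P i j = μ i) ∧ (∀ j, ∑ i, P i j = ν j)}

/-- Entropically regularized transport cost `⟨C, P⟩ + η⁻¹ ∑_{ij} P_ij log P_ij`
(with the convention `0 log 0 = 0`, which holds since `Real.log 0 = 0`). -/
noncomputable def entOTObj (n : ℕ) (η : ℝ) (C P : Matrix (Fin n) (Fin n) ℝ) : ℝ :=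
  (∑ i, ∑ j, C i j * P i j) + η⁻¹ * ∑ i, ∑ j, P i j * Real.log (P i j)

theorem isCompact_transportPolytope (n : ℕ) (μ ν : Fin n → ℝ) :
    IsCompact (transportPolytope n μ ν) := by
  have hbox : IsCompact (Set.pi Set.univ fun _ : Fin n => Set.pi Set.univ fun _ : Fin n =>
      Set.Icc (0 : ℝ) 1) :=
    isCompact_univ_pi fun _ => isCompact_univ_pi fun _ => isCompact_Icc
  refine hbox.of_isClosed_subset ?_ ?_
  · simp only [transportPolytope, Set.ofPred_and, Set.ofPred_forall]
    refine IsClosed.inter ?_ (IsClosed.inter ?_ (IsClosed.inter ?_ ?_))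
    · exact isClosed_iInter fun i => isClosed_iInter fun j =>
        isClosed_le continuous_const (by fun_prop)
    · exact isClosed_eq (by fun_prop) continuous_const
    · exact isClosed_iInter fun i => isClosed_eq (by fun_prop) continuous_const
    · exact isClosed_iInter fun j => isClosed_eq (by fun_prop) continuous_const
  · rintro P ⟨h0, h1, -, -⟩ i - j -
    refine ⟨h0 i j, ?_⟩
    calc P i j ≤ ∑ j, P i j :=
          Finset.single_le_sum (fun b _ => h0 i b) (Finset.mem_univ j)
      _ ≤ ∑ i, ∑ j, P i j :=
          Finset.single_le_sum (f := fun i => ∑ j, P i j)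
            (fun a _ => Finset.sum_nonneg fun b _ => h0 a b) (Finset.mem_univ i)
      _ = 1 := h1

theorem continuous_entOTObj (n : ℕ) (η : ℝ) (C : Matrix (Fin n) (Fin n) ℝ) :
    Continuous (entOTObj n η C) := by
  have hent (i j : Fin n) :
      Continuous fun P : Matrix (Fin n) (Fin n) ℝ => P i j * Real.log (P i j) :=
    Real.continuous_mul_log.comp (by fun_prop)
  unfold entOTObj
  fun_prop

theorem product_mem_transportPolytope {n : ℕ} {μ ν : Fin n → ℝ}
    (hμ : ∀ i, 0 ≤ μ i) (hμsum : ∑ i, μ i = 1) (hν : ∀ j, 0 ≤ ν j) (hνsum : ∑ j, ν j = 1) :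
    (fun i j => μ i * ν j : Matrix (Fin n) (Fin n) ℝ) ∈ transportPolytope n μ ν := by
  refine ⟨fun i j => mul_nonneg (hμ i) (hν j), ?_, fun i => ?_, fun j => ?_⟩
  · simp [← Finset.mul_sum, hνsum, hμsum]
  · simp [← Finset.mul_sum, hνsum]
  · simp [← Finset.sum_mul, hμsum]

theorem convex_transportPolytope (n : ℕ) (μ ν : Fin n → ℝ) :
    Convex ℝ (transportPolytope n μ ν) := by
  rintro P ⟨hP0, hP1, hPr, hPc⟩ Q ⟨hQ0, hQ1, hQr, hQc⟩ a b ha hb hab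
  refine ⟨fun i j => ?_, ?_, fun i => ?_, fun j => ?_⟩
  · exact add_nonneg (mul_nonneg ha (hP0 i j)) (mul_nonneg hb (hQ0 i j))
  · simp [Finset.sum_add_distrib, ← Finset.mul_sum, hP1, hQ1, hab]
  · simp [Finset.sum_add_distrib, ← Finset.mul_sum, hPr, hQr, ← add_mul, hab]
  · simp [Finset.sum_add_distrib, ← Finset.mul_sum, hPc, hQc, ← add_mul, hab]

/-- A zero entry of `P` forces an extra decrease of order `t log t` along the segment from
`P` to a matrix whose corresponding entry is positive. -/
theorem entOTObj_segment_le {n : ℕ} {η : ℝ} (hη : 0 < η) (C : Matrix (Fin n) (Fin n) ℝ)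
    {P Q : Matrix (Fin n) (Fin n) ℝ} (hP : ∀ i j, 0 ≤ P i j) (hQ : ∀ i j, 0 < Q i j)
    {a b : Fin n} (hab : P a b = 0) {t : ℝ} (ht0 : 0 < t) (ht1 : t ≤ 1) :
    entOTObj n η C ((1 - t) • P + t • Q) ≤
      (1 - t) * entOTObj n η C P + t * entOTObj n η C Q + η⁻¹ * (t * Q a b * Real.log t) := by
  have entry (i j : Fin n) : ((1 - t) • P + t • Q) i j * Real.log (((1 - t) • P + t • Q) i j) ≤
      (1 - t) * (P i j * Real.log (P i j)) + t * (Q i j * Real.log (Q i j)) +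
        if i = a then (if j = b then t * Q a b * Real.log t else 0) else 0 := by
    by_cases h : i = a ∧ j = b
    · obtain ⟨rfl, rfl⟩ := h
      simp only [Matrix.add_apply, Matrix.smul_apply, hab, smul_eq_mul, mul_zero, zero_add,
        if_true, zero_mul, Real.log_mul ht0.ne' (hQ i j).ne']
      exact le_of_eq (by ring)
    · have hite : (if i = a then (if j = b then t * Q a b * Real.log t else 0) else 0) = 0 := by
        split_ifs <;> tauto
      rw [hite, add_zero]
      exact Real.convexOn_mul_log.2 (hP i j) (hQ i j).le (sub_nonneg.2 ht1) ht0.le (by ring)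
  have hsum := Finset.sum_le_sum fun i (_ : i ∈ Finset.univ) =>
    Finset.sum_le_sum fun j (_ : j ∈ Finset.univ) => entry i j
  simp only [Finset.sum_add_distrib, ← Finset.mul_sum, Finset.sum_ite_irrel,
    Finset.sum_ite_eq', Finset.sum_const_zero, Finset.mem_univ, if_true] at hsum
  have hlin : ∑ i, ∑ j, C i j * ((1 - t) • P + t • Q) i j =
      (1 - t) * ∑ i, ∑ j, C i j * P i j + t * ∑ i, ∑ j, C i j * Q i j := by
    simp only [Finset.mul_sum, ← Finset.sum_add_distrib, Matrix.add_apply, Matrix.smul_apply,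
      smul_eq_mul]
    exact Finset.sum_congr rfl fun i _ => Finset.sum_congr rfl fun j _ => by ring
  have := mul_le_mul_of_nonneg_left hsum (inv_nonneg.2 hη.le)
  unfold entOTObj
  rw [hlin]
  linarith

theorem pos_of_isMinOn_entOTObj {n : ℕ} {η : ℝ} (hη : 0 < η) {C : Matrix (Fin n) (Fin n) ℝ}
    {μ ν : Fin n → ℝ} (hμ : ∀ i, 0 < μ i) (hμsum : ∑ i, μ i = 1)
    (hν : ∀ j, 0 < ν j) (hνsum : ∑ j, ν j = 1) {P : Matrix (Fin n) (Fin n) ℝ}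
    (hP : P ∈ transportPolytope n μ ν)
    (hmin : IsMinOn (entOTObj n η C) (transportPolytope n μ ν) P) (a b : Fin n) :
    0 < P a b := by
  refine (hP.1 a b).lt_of_ne' fun hab => ?_
  set Q : Matrix (Fin n) (Fin n) ℝ := fun i j => μ i * ν j
  have hQ : Q ∈ transportPolytope n μ ν :=
    product_mem_transportPolytope (fun i => (hμ i).le) hμsum (fun j => (hν j).le) hνsum
  have hQpos (i j : Fin n) : 0 < Q i j := mul_pos (hμ i) (hν j)
  have hgap : 0 ≤ entOTObj n η C Q - entOTObj n η C P := sub_nonneg.2 (hmin hQ)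
  set s := η * (entOTObj n η C Q - entOTObj n η C P) / Q a b + 1 with hs
  have hs0 : 0 ≤ s :=
    add_nonneg (div_nonneg (mul_nonneg hη.le hgap) (hQpos a b).le) zero_le_one
  have ht0 := Real.exp_pos (-s)
  have ht1 : Real.exp (-s) ≤ 1 := Real.exp_le_one_iff.2 (neg_nonpos.2 hs0)
  have hle := entOTObj_segment_le hη C hP.1 hQpos hab ht0 ht1
  have hge : entOTObj n η C P ≤ _ := hmin
    (convex_transportPolytope n μ ν hP hQ (sub_nonneg.2 ht1) ht0.le (sub_add_cancel _ _))
  have hslope : η⁻¹ * (Q a b * s) =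
      entOTObj n η C Q - entOTObj n η C P + η⁻¹ * Q a b := by
    rw [hs]
    field_simp [(hQpos a b).ne']
  rw [Real.log_exp] at hle
  have hdec : 0 < Real.exp (-s) * (η⁻¹ * Q a b) :=
    mul_pos ht0 (mul_pos (inv_pos.2 hη) (hQpos a b))
  have := congrArg (fun z => Real.exp (-s) * z) hslope
  nlinarith

theorem add_smul_rankOne_mem_transportPolytope {n : ℕ} {μ ν : Fin n → ℝ}
    {P : Matrix (Fin n) (Fin n) ℝ} (hP : P ∈ transportPolytope n μ ν) {x y : Fin n → ℝ}
    (hx : ∑ i, x i = 0) (hy : ∑ j, y j = 0) {t : ℝ}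
    (ht : ∀ i j, 0 ≤ P i j + t * (x i * y j)) :
    (fun i j => P i j + t * (x i * y j) : Matrix (Fin n) (Fin n) ℝ) ∈
      transportPolytope n μ ν := by
  obtain ⟨-, h1, hr, hc⟩ := hP
  refine ⟨ht, ?_, fun i => ?_, fun j => ?_⟩
  · simp [Finset.sum_add_distrib, ← Finset.mul_sum, h1, hy]
  · simp [Finset.sum_add_distrib, ← Finset.mul_sum, hr, hy]
  · simp [Finset.sum_add_distrib, ← Finset.mul_sum, ← Finset.sum_mul, hc, hx]

/-- First-order optimality at a positive minimizer, in the rank-one direction `x yᵀ`. -/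
theorem sum_gradient_eq_zero {n : ℕ} {η : ℝ} {C : Matrix (Fin n) (Fin n) ℝ}
    {μ ν : Fin n → ℝ} {P : Matrix (Fin n) (Fin n) ℝ} (hP : P ∈ transportPolytope n μ ν)
    (hpos : ∀ i j, 0 < P i j)
    (hmin : IsMinOn (entOTObj n η C) (transportPolytope n μ ν) P) {x y : Fin n → ℝ}
    (hx : ∑ i, x i = 0) (hy : ∑ j, y j = 0) :
    (∑ i, ∑ j, C i j * (x i * y j)) +
      η⁻¹ * ∑ i, ∑ j, (Real.log (P i j) + 1) * (x i * y j) = 0 := by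
  have hline (i j : Fin n) :
      HasDerivAt (fun t : ℝ => P i j + t * (x i * y j)) (x i * y j) 0 := by
    simpa using ((hasDerivAt_id (0 : ℝ)).mul_const (x i * y j)).const_add (P i j)
  have hent (i j : Fin n) :
      HasDerivAt (fun t : ℝ => (P i j + t * (x i * y j)) * Real.log (P i j + t * (x i * y j)))
        ((Real.log (P i j) + 1) * (x i * y j)) 0 := by
    have hlog : HasDerivAt (fun z : ℝ => z * Real.log z) (Real.log (P i j) + 1)
        (P i j + 0 * (x i * y j)) := by
      simpa using Real.hasDerivAt_mul_log (hpos i j).ne'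
    exact hlog.comp 0 (hline i j)
  have hderiv : HasDerivAt
      (fun t : ℝ => entOTObj n η C (fun i j => P i j + t * (x i * y j)))
      ((∑ i, ∑ j, C i j * (x i * y j)) +
        η⁻¹ * ∑ i, ∑ j, (Real.log (P i j) + 1) * (x i * y j)) 0 := by
    unfold entOTObj
    refine HasDerivAt.add ?_ (HasDerivAt.const_mul _ ?_)
    · exact HasDerivAt.fun_sum fun i _ => HasDerivAt.fun_sum fun j _ =>
        (hline i j).const_mul (C i j)
    · exact HasDerivAt.fun_sum fun i _ => HasDerivAt.fun_sum fun j _ => hent i j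
  refine IsLocalMin.hasDerivAt_eq_zero ?_ hderiv
  have hev : ∀ᶠ t : ℝ in nhds 0, ∀ i j, 0 < P i j + t * (x i * y j) := by
    refine Filter.eventually_all.2 fun i => Filter.eventually_all.2 fun j => ?_
    exact (hline i j).continuousAt.eventually_const_lt (by simpa using hpos i j)
  filter_upwards [hev] with t ht
  have hle : entOTObj n η C P ≤ _ := hmin
    (add_smul_rankOne_mem_transportPolytope hP hx hy fun i j => (ht i j).le)
  simpa using hle

theorem exists_scaling_of_isMinOn_entOTObj {n : ℕ} {η : ℝ} (hη : 0 < η)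
    {C : Matrix (Fin n) (Fin n) ℝ} {μ ν : Fin n → ℝ} {P : Matrix (Fin n) (Fin n) ℝ}
    (hP : P ∈ transportPolytope n μ ν) (hpos : ∀ i j, 0 < P i j)
    (hmin : IsMinOn (entOTObj n η C) (transportPolytope n μ ν) P) (o : Fin n) :
    ∃ u v : Fin n → ℝ, (∀ i, 0 < u i) ∧ (∀ j, 0 < v j) ∧
      ∀ i j, P i j = u i * Real.exp (-η * C i j) * v j := by
  refine ⟨fun i => Real.exp (Real.log (P i o) + η * C i o),
    fun j => Real.exp (Real.log (P o j) + η * C o j - (Real.log (P o o) + η * C o o)),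
    fun i => Real.exp_pos _, fun j => Real.exp_pos _, fun i j => ?_⟩
  have hgrad := sum_gradient_eq_zero hP hpos hmin
    (x := Pi.single i 1 - Pi.single o 1) (y := Pi.single j 1 - Pi.single o 1)
    (by simp) (by simp)
  simp only [Pi.sub_apply, mul_sub, Finset.sum_sub_distrib, Pi.single_apply, mul_ite,
    mul_one, mul_zero, Finset.sum_ite_eq', Finset.mem_univ, if_true] at hgrad
  field_simp at hgrad
  rw [← Real.exp_add, ← Real.exp_add]
  conv_lhs => rw [← Real.exp_log (hpos i j)]
  congr 1
  linarith

theorem mul_log_sub_mul_log_nonneg {p q : ℝ} (hp : 0 < p) (hq : 0 ≤ q) :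
    0 ≤ q * Real.log q - q * Real.log p - q + p ∧
      (q * Real.log q - q * Real.log p - q + p = 0 → q = p) := by
  rcases hq.eq_or_lt with rfl | hq
  · simp [hp.le, hp.ne']
  · have hlog : Real.log (p / q) = Real.log p - Real.log q := Real.log_div hp.ne' hq.ne'
    have hmul : q * (p / q) = p := by field_simp
    constructor
    · nlinarith [Real.log_le_sub_one_of_pos (div_pos hp hq)]
    · intro h
      by_contra hne
      have hlt := Real.log_lt_sub_one_of_pos (div_pos hp hq)
        fun h => hne ((div_eq_one_iff_eq hq.ne').1 h).symm
      nlinarith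

/-- The optimality gap of a matrix of scaling form is a relative entropy. -/
theorem entOTObj_sub_eq_of_scaling {n : ℕ} {η : ℝ} (hη : 0 < η)
    {C : Matrix (Fin n) (Fin n) ℝ} {μ ν : Fin n → ℝ} {P Q : Matrix (Fin n) (Fin n) ℝ}
    (hP : P ∈ transportPolytope n μ ν) (hQ : Q ∈ transportPolytope n μ ν) {u v : Fin n → ℝ}
    (hu : ∀ i, 0 < u i) (hv : ∀ j, 0 < v j)
    (hscale : ∀ i j, P i j = u i * Real.exp (-η * C i j) * v j) :
    entOTObj n η C Q - entOTObj n η C P = η⁻¹ * ∑ i, ∑ j,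
      (Q i j * Real.log (Q i j) - Q i j * Real.log (P i j) - Q i j + P i j) := by
  have hlog (i j : Fin n) :
      Real.log (P i j) = Real.log (u i) - η * C i j + Real.log (v j) := by
    rw [hscale, Real.log_mul (mul_pos (hu i) (Real.exp_pos _)).ne' (hv j).ne',
      Real.log_mul (hu i).ne' (Real.exp_pos _).ne', Real.log_exp]
    ring
  have hpot {R : Matrix (Fin n) (Fin n) ℝ} (hR : R ∈ transportPolytope n μ ν) :
      ∑ i, ∑ j, R i j * Real.log (P i j) =
        ∑ i, μ i * Real.log (u i) + ∑ j, ν j * Real.log (v j) -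
          η * ∑ i, ∑ j, C i j * R i j := by
    have hrow : ∑ i, μ i * Real.log (u i) = ∑ i, ∑ j, R i j * Real.log (u i) := by
      simp only [← Finset.sum_mul, hR.2.2.1]
    have hcol : ∑ j, ν j * Real.log (v j) = ∑ i, ∑ j, R i j * Real.log (v j) := by
      rw [Finset.sum_comm]
      simp only [← Finset.sum_mul, hR.2.2.2]
    rw [hrow, hcol]
    simp only [Finset.mul_sum, ← Finset.sum_add_distrib, ← Finset.sum_sub_distrib]
    exact Finset.sum_congr rfl fun i _ => Finset.sum_congr rfl fun j _ => by rw [hlog]; ring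
  simp only [Finset.sum_add_distrib, Finset.sum_sub_distrib, hP.2.1, hQ.2.1, entOTObj,
    hpot hP, hpot hQ]
  field_simp
  ring

theorem isMinOn_entOTObj_of_scaling {n : ℕ} {η : ℝ} (hη : 0 < η)
    {C : Matrix (Fin n) (Fin n) ℝ} {μ ν : Fin n → ℝ} {P : Matrix (Fin n) (Fin n) ℝ}
    (hP : P ∈ transportPolytope n μ ν) {u v : Fin n → ℝ}
    (hu : ∀ i, 0 < u i) (hv : ∀ j, 0 < v j)
    (hscale : ∀ i j, P i j = u i * Real.exp (-η * C i j) * v j) :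
    IsMinOn (entOTObj n η C) (transportPolytope n μ ν) P ∧
      ∀ Q ∈ transportPolytope n μ ν, entOTObj n η C Q ≤ entOTObj n η C P → Q = P := by
  have hpos (i j : Fin n) : 0 < P i j := by
    rw [hscale]
    exact mul_pos (mul_pos (hu i) (Real.exp_pos _)) (hv j)
  have hnn {Q : Matrix (Fin n) (Fin n) ℝ} (hQ : Q ∈ transportPolytope n μ ν) (i j : Fin n) :=
    (mul_log_sub_mul_log_nonneg (hpos i j) (hQ.1 i j)).1
  have hrow {Q : Matrix (Fin n) (Fin n) ℝ} (hQ : Q ∈ transportPolytope n μ ν) (i : Fin n) :=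
    Finset.sum_nonneg fun j (_ : j ∈ Finset.univ) => hnn hQ i j
  have hsum {Q : Matrix (Fin n) (Fin n) ℝ} (hQ : Q ∈ transportPolytope n μ ν) :=
    Finset.sum_nonneg fun i (_ : i ∈ Finset.univ) => hrow hQ i
  refine ⟨fun Q hQ => ?_, fun Q hQ hle => ?_⟩
  · change entOTObj n η C P ≤ entOTObj n η C Q
    refine sub_nonneg.1 ?_
    rw [entOTObj_sub_eq_of_scaling hη hP hQ hu hv hscale]
    exact mul_nonneg (inv_nonneg.2 hη.le) (hsum hQ)
  · have hle' := sub_nonpos.2 hle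
    rw [entOTObj_sub_eq_of_scaling hη hP hQ hu hv hscale] at hle'
    have hzero := le_antisymm (nonpos_of_mul_nonpos_right hle' (inv_pos.2 hη)) (hsum hQ)
    ext i j
    refine (mul_log_sub_mul_log_nonneg (hpos i j) (hQ.1 i j)).2 ?_
    have hzero_row := (Finset.sum_eq_zero_iff_of_nonneg fun i _ => hrow hQ i).1 hzero i
      (Finset.mem_univ i)
    exact (Finset.sum_eq_zero_iff_of_nonneg fun j _ => hnn hQ i j).1 hzero_row j
      (Finset.mem_univ j)

/-- **Entropic Optimal Transport is Matrix Scaling.** For `η > 0` and strictly positive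
marginals, the entropic OT problem over `U(μ,ν)` has a unique minimizer `P*`, and `P*` is
characterized as the unique element of `U(μ,ν)` of the form
`P* i j = u i * exp (-η C i j) * v j` with `u, v > 0`, i.e. the Matrix Scaling solution
for `K = exp[-ηC]`. -/
theorem entropic_OT_is_matrix_scaling
    (n : ℕ) (hn : 1 ≤ n) (η : ℝ) (hη : 0 < η)
    (C : Matrix (Fin n) (Fin n) ℝ) (μ ν : Fin n → ℝ)
    (hμpos : ∀ i, 0 < μ i) (hμsum : ∑ i, μ i = 1)
    (hνpos : ∀ j, 0 < ν j) (hνsum : ∑ j, ν j = 1) :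
    ∃ P : Matrix (Fin n) (Fin n) ℝ,
      P ∈ transportPolytope n μ ν ∧
      (∀ Q ∈ transportPolytope n μ ν, entOTObj n η C P ≤ entOTObj n η C Q) ∧
      (∀ Q ∈ transportPolytope n μ ν,
        (∀ R ∈ transportPolytope n μ ν, entOTObj n η C Q ≤ entOTObj n η C R) → Q = P) ∧
      (∃ u v : Fin n → ℝ, (∀ i, 0 < u i) ∧ (∀ j, 0 < v j) ∧
        ∀ i j, P i j = u i * Real.exp (-η * C i j) * v j) ∧
      (∀ Q ∈ transportPolytope n μ ν,
        (∃ u v : Fin n → ℝ, (∀ i, 0 < u i) ∧ (∀ j, 0 < v j) ∧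
          ∀ i j, Q i j = u i * Real.exp (-η * C i j) * v j) → Q = P) := by
  obtain ⟨P, hP, hmin⟩ := (isCompact_transportPolytope n μ ν).exists_isMinOn
    ⟨_, product_mem_transportPolytope (fun i => (hμpos i).le) hμsum
      (fun j => (hνpos j).le) hνsum⟩
    (continuous_entOTObj n η C).continuousOn
  have hpos := pos_of_isMinOn_entOTObj hη hμpos hμsum hνpos hνsum hP hmin
  obtain ⟨u, v, hu, hv, hscale⟩ :=
    exists_scaling_of_isMinOn_entOTObj hη hP hpos hmin ⟨0, hn⟩
  have huniq := (isMinOn_entOTObj_of_scaling hη hP hu hv hscale).2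
  refine ⟨P, hP, fun Q hQ => hmin hQ, fun Q hQ hQmin => huniq Q hQ (hQmin P hP),
    ⟨u, v, hu, hv, hscale⟩, ?_⟩
  rintro Q hQ ⟨u', v', hu', hv', hscale'⟩
  exact huniq Q hQ ((isMinOn_entOTObj_of_scaling hη hQ hu' hv' hscale').1 hP)
end

section
/- Let n ≥ 1, η > 0, and C ∈ ℝ^{n×n}. Then the entropically regularized Minimum Mean Cycle problem min over P ∈ Δ_{n×n} with Σ_j P_ij = Σ_j P_ji for all i, of Σ_{ij} C_ij P_ij + η^{-1} Σ_{ij} P_ij log P_ij, has a unique minimizer P*. Moreover, P* is characterized as the unique element of the normalized circulation polytope of the form P*_ij = λ · d_i e^{-η C_ij} / d_j for some strictly positive vector d ∈ ℝ^n and normalizing constant λ > 0; that is, P* is the solution to the Matrix Balancing problem for K = exp[-ηC] (entrywise exponential), normalized so its entries sum to 1. -/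
/-- The normalized circulation polytope: joint distributions with symmetric marginals. -/
def circulationPolytope (n : ℕ) : Set (Matrix (Fin n) (Fin n) ℝ) :=
  {P | (∀ i j, 0 ≤ P i j) ∧ (∑ i, ∑ j, P i j) = 1 ∧
       (∀ i, ∑ j, P i j = ∑ j, P j i)}

/-- Entropically regularized cost `⟨C, P⟩ + η⁻¹ ∑_{ij} P_ij log P_ij`
(with the convention `0 log 0 = 0`, which holds since `Real.log 0 = 0`). -/
noncomputable def entMMCObj (n : ℕ) (η : ℝ) (C P : Matrix (Fin n) (Fin n) ℝ) : ℝ :=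
  (∑ i, ∑ j, C i j * P i j) + η⁻¹ * ∑ i, ∑ j, P i j * Real.log (P i j)

/-- For every positive matrix `K`, the function `x ↦ ∑ i j, K i j * exp (x i - x j)` attains its
infimum. -/
lemma exists_forall_sum_exp_sub_le {n : ℕ} (hn : 1 ≤ n) (K : Fin n → Fin n → ℝ)
    (hK : ∀ i j, 0 < K i j) :
    ∃ x : Fin n → ℝ, ∀ y : Fin n → ℝ,
      ∑ i, ∑ j, K i j * Real.exp (x i - x j) ≤ ∑ i, ∑ j, K i j * Real.exp (y i - y j) := by
  set S := ∑ i, ∑ j, K i j with hS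
  have hS0 : 0 ≤ S := Finset.sum_nonneg fun i _ => Finset.sum_nonneg fun j _ => (hK i j).le
  have hSK : ∀ i j, 0 ≤ S / K i j := fun i j => div_nonneg hS0 (hK i j).le
  set M := ∑ i, ∑ j, S / K i j
  have hM0 : 0 ≤ M := Finset.sum_nonneg fun i _ => Finset.sum_nonneg fun j _ => hSK i j
  have hMle : ∀ i j, S / K i j ≤ M := fun i j =>
    (Finset.single_le_sum (f := fun j => S / K i j) (fun j _ => hSK i j)
      (Finset.mem_univ j)).trans
    (Finset.single_le_sum (f := fun i => ∑ j, S / K i j)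
      (fun i _ => Finset.sum_nonneg fun j _ => hSK i j) (Finset.mem_univ i))
  obtain ⟨x, -, hx⟩ := (isCompact_Icc (a := fun _ : Fin n => -M) (b := fun _ => M)).exists_isMinOn
    ⟨fun _ => 0, fun _ => neg_nonpos.2 hM0, fun _ => hM0⟩
    (f := fun x : Fin n → ℝ => ∑ i, ∑ j, K i j * Real.exp (x i - x j))
    (by fun_prop)
  rw [isMinOn_iff] at hx
  refine ⟨x, fun y => ?_⟩
  let o : Fin n := ⟨0, hn⟩
  by_cases hy : ∀ i j, y i - y j ≤ M
  · have := hx (fun i => y i - y o)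
      ⟨fun i => by have := hy o i; simp only; linarith, fun i => hy i o⟩
    simpa using this
  · push Not at hy
    obtain ⟨i, j, hij⟩ := hy
    have h0 := hx (fun _ => 0) ⟨fun _ => neg_nonpos.2 hM0, fun _ => hM0⟩
    simp only [sub_self, Real.exp_zero, mul_one, ← hS] at h0
    have hterm : ∀ a b, 0 ≤ K a b * Real.exp (y a - y b) := fun a b =>
      mul_nonneg (hK a b).le (Real.exp_nonneg _)
    calc _ ≤ S := h0
      _ ≤ M * K i j := (div_le_iff₀ (hK i j)).1 (hMle i j)
      _ ≤ K i j * Real.exp (y i - y j) := by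
        rw [mul_comm]
        gcongr
        · exact (hK i j).le
        · linarith [Real.add_one_le_exp (y i - y j)]
      _ ≤ ∑ b, K i b * Real.exp (y i - y b) :=
        Finset.single_le_sum (f := fun b => K i b * Real.exp (y i - y b))
          (fun b _ => hterm i b) (Finset.mem_univ j)
      _ ≤ _ := Finset.single_le_sum (f := fun a => ∑ b, K a b * Real.exp (y a - y b))
          (fun a _ => Finset.sum_nonneg fun b _ => hterm a b) (Finset.mem_univ i)

/-- Every positive matrix can be balanced by a positive diagonal similarity. -/
lemma exists_balancing {n : ℕ} (hn : 1 ≤ n) (K : Fin n → Fin n → ℝ) (hK : ∀ i j, 0 < K i j) :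
    ∃ d : Fin n → ℝ, (∀ i, 0 < d i) ∧
      ∀ i, ∑ j, d i * K i j / d j = ∑ j, d j * K j i / d i := by
  obtain ⟨x, hx⟩ := exists_forall_sum_exp_sub_le hn K hK
  refine ⟨fun i => Real.exp (x i), fun i => Real.exp_pos _, fun k => ?_⟩
  let e : Fin n → ℝ := Pi.single k 1
  have hderiv : HasDerivAt
      (fun t : ℝ => ∑ i, ∑ j, K i j * Real.exp ((x i + t * e i) - (x j + t * e j)))
      (∑ i, ∑ j, K i j * (Real.exp (x i - x j) * (e i - e j))) 0 := by
    refine HasDerivAt.fun_sum fun i _ => HasDerivAt.fun_sum fun j _ => ?_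
    have h : ∀ a, HasDerivAt (fun t : ℝ => x a + t * e a) (e a) 0 := fun a => by
      simpa using ((hasDerivAt_id (0 : ℝ)).mul_const (e a)).const_add (x a)
    simpa using (((h i).sub (h j)).exp).const_mul (K i j)
  have hmin : IsLocalMin
      (fun t : ℝ => ∑ i, ∑ j, K i j * Real.exp ((x i + t * e i) - (x j + t * e j))) 0 :=
    Filter.Eventually.of_forall fun t => by simpa using hx fun i => x i + t * e i
  have h0 := hmin.hasDerivAt_eq_zero hderiv
  have hsplit : ∑ i, ∑ j, K i j * (Real.exp (x i - x j) * (e i - e j)) =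
      ∑ j, K k j * Real.exp (x k - x j) - ∑ i, K i k * Real.exp (x i - x k) := by
    simp_rw [mul_sub, Finset.sum_sub_distrib]
    congr 1
    · rw [Finset.sum_eq_single k]
      · simp [e]
      · intro b _ hb
        simp [e, hb]
      · simp
    · refine Finset.sum_congr rfl fun i _ => ?_
      rw [Finset.sum_eq_single k]
      · simp [e]
      · intro b _ hb
        simp [e, hb]
      · simp
  have hterm : ∀ i j, Real.exp (x i) * K i j / Real.exp (x j) = K i j * Real.exp (x i - x j) :=
    fun i j => by rw [Real.exp_sub]; ring
  simp_rw [hterm]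
  linarith

/-- On the circulation polytope, the entropic objective is, up to a constant, the relative entropy
to any element of the polytope that is a positive diagonal scaling of `exp[-ηC]`. -/
lemma entMMCObj_eq_sum_klFun {n : ℕ} {η : ℝ} (hη : 0 < η) {C P R : Matrix (Fin n) (Fin n) ℝ}
    {d : Fin n → ℝ} {lam : ℝ} (hd : ∀ i, 0 < d i) (hlam : 0 < lam)
    (hP : P ∈ circulationPolytope n) (hR : R ∈ circulationPolytope n)
    (hPd : ∀ i j, P i j = lam * (d i * Real.exp (-η * C i j) / d j)) :
    entMMCObj n η C R =
      η⁻¹ * (∑ i, ∑ j, P i j * InformationTheory.klFun (R i j / P i j)) +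
        η⁻¹ * Real.log lam := by
  have hterm : ∀ i j, P i j * InformationTheory.klFun (R i j / P i j) =
      η * (C i j * R i j) + R i j * Real.log (R i j) + P i j - R i j - Real.log lam * R i j
        - (Real.log (d i) * R i j - Real.log (d j) * R i j) := by
    intro i j
    have hdi := hd i
    have hdj := hd j
    have hpos : 0 < P i j := by rw [hPd]; positivity
    have hlog : Real.log (P i j) =
        Real.log lam + (Real.log (d i) + -η * C i j - Real.log (d j)) := by
      rw [hPd, Real.log_mul hlam.ne' (by positivity), Real.log_div (by positivity) hdj.ne',
        Real.log_mul hdi.ne' (by positivity), Real.log_exp]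
    rw [InformationTheory.klFun]
    rcases eq_or_ne (R i j) 0 with h | h
    · simp [h]
    · rw [Real.log_div h hpos.ne', hlog]
      field_simp
      ring
  have hcirc : ∑ i, ∑ j, Real.log (d i) * R i j = ∑ i, ∑ j, Real.log (d j) * R i j := by
    rw [Finset.sum_comm (f := fun i j => Real.log (d j) * R i j)]
    simp_rw [← Finset.mul_sum]
    exact Finset.sum_congr rfl fun i _ => by rw [hR.2.2 i]
  simp_rw [hterm, Finset.sum_sub_distrib, Finset.sum_add_distrib, hcirc, ← Finset.mul_sum]
  rw [hP.2.1, hR.2.1, entMMCObj]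
  field_simp
  ring

/-- An element of the circulation polytope that is a positive diagonal scaling of `exp[-ηC]`
is the unique minimizer of the entropic objective. -/
lemma entMMCObj_lt_of_scaling {n : ℕ} {η : ℝ} (hη : 0 < η) {C P Q : Matrix (Fin n) (Fin n) ℝ}
    {d : Fin n → ℝ} {lam : ℝ} (hd : ∀ i, 0 < d i) (hlam : 0 < lam)
    (hP : P ∈ circulationPolytope n) (hQ : Q ∈ circulationPolytope n)
    (hPd : ∀ i j, P i j = lam * (d i * Real.exp (-η * C i j) / d j)) (hne : Q ≠ P) :
    entMMCObj n η C P < entMMCObj n η C Q := by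
  have hpos : ∀ i j, 0 < P i j := fun i j => by
    have := hd i
    have := hd j
    rw [hPd]; positivity
  have hnonneg : ∀ i j, 0 ≤ P i j * InformationTheory.klFun (Q i j / P i j) := fun i j =>
    mul_nonneg (hpos i j).le
      (InformationTheory.klFun_nonneg (div_nonneg (hQ.1 i j) (hpos i j).le))
  have hPP : ∑ i, ∑ j, P i j * InformationTheory.klFun (P i j / P i j) = 0 := by
    simp [div_self (hpos _ _).ne', InformationTheory.klFun_one]
  have hlt : 0 < ∑ i, ∑ j, P i j * InformationTheory.klFun (Q i j / P i j) := by
    refine lt_of_le_of_ne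
      (Finset.sum_nonneg fun i _ => Finset.sum_nonneg fun j _ => hnonneg i j) fun h => hne ?_
    ext i j
    have h1 := (Finset.sum_eq_zero_iff_of_nonneg fun i _ =>
      Finset.sum_nonneg fun j _ => hnonneg i j).1 h.symm i (Finset.mem_univ i)
    have h2 := (Finset.sum_eq_zero_iff_of_nonneg fun j _ => hnonneg i j).1 h1 j
      (Finset.mem_univ j)
    have h3 := (mul_eq_zero.1 h2).resolve_left (hpos i j).ne'
    rw [InformationTheory.klFun_eq_zero_iff (div_nonneg (hQ.1 i j) (hpos i j).le)] at h3
    exact (div_eq_one_iff_eq (hpos i j).ne').1 h3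
  rw [entMMCObj_eq_sum_klFun hη hd hlam hP hP hPd, entMMCObj_eq_sum_klFun hη hd hlam hP hQ hPd,
    hPP]
  gcongr

/-- **Entropic Minimum Mean Cycle is Matrix Balancing.** For `η > 0`, the entropic MMC
problem over the normalized circulation polytope has a unique minimizer `P*`, and `P*` is
characterized as the unique element of the polytope of the form
`P* i j = λ * d i * exp (-η C i j) / d j` with `d > 0` and `λ > 0`, i.e. the
(normalized) Matrix Balancing solution for `K = exp[-ηC]`. -/
theorem entropic_MMC_is_matrix_balancing
    (n : ℕ) (hn : 1 ≤ n) (η : ℝ) (hη : 0 < η)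
    (C : Matrix (Fin n) (Fin n) ℝ) :
    ∃ P : Matrix (Fin n) (Fin n) ℝ,
      P ∈ circulationPolytope n ∧
      (∀ Q ∈ circulationPolytope n, entMMCObj n η C P ≤ entMMCObj n η C Q) ∧
      (∀ Q ∈ circulationPolytope n,
        (∀ R ∈ circulationPolytope n, entMMCObj n η C Q ≤ entMMCObj n η C R) → Q = P) ∧
      (∃ (d : Fin n → ℝ) (lam : ℝ), (∀ i, 0 < d i) ∧ 0 < lam ∧
        ∀ i j, P i j = lam * (d i * Real.exp (-η * C i j) / d j)) ∧
      (∀ Q ∈ circulationPolytope n,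
        (∃ (d : Fin n → ℝ) (lam : ℝ), (∀ i, 0 < d i) ∧ 0 < lam ∧
          ∀ i j, Q i j = lam * (d i * Real.exp (-η * C i j) / d j)) → Q = P) := by
  obtain ⟨d, hd, hbal⟩ := exists_balancing hn (fun i j => Real.exp (-η * C i j))
    fun i j => Real.exp_pos _
  have hpos : ∀ i j, 0 < d i * Real.exp (-η * C i j) / d j := fun i j =>
    div_pos (mul_pos (hd i) (Real.exp_pos _)) (hd j)
  set Z := ∑ i, ∑ j, d i * Real.exp (-η * C i j) / d j
  have : Nonempty (Fin n) := ⟨⟨0, hn⟩⟩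
  have hZ0 : 0 < Z := Finset.sum_pos
    (fun i _ => Finset.sum_pos (fun j _ => hpos i j) Finset.univ_nonempty) Finset.univ_nonempty
  let P : Matrix (Fin n) (Fin n) ℝ := fun i j => Z⁻¹ * (d i * Real.exp (-η * C i j) / d j)
  have hPd : ∀ i j, P i j = Z⁻¹ * (d i * Real.exp (-η * C i j) / d j) := fun _ _ => rfl
  have hP : P ∈ circulationPolytope n := by
    refine ⟨fun i j => mul_nonneg (inv_pos.2 hZ0).le (hpos i j).le, ?_, fun i => ?_⟩
    · simp_rw [hPd, ← Finset.mul_sum]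
      exact inv_mul_cancel₀ hZ0.ne'
    · simp_rw [hPd, ← Finset.mul_sum]
      rw [hbal i]
  have hmin := fun Q hQ => entMMCObj_lt_of_scaling hη hd (inv_pos.2 hZ0) hP (Q := Q) hQ hPd
  refine ⟨P, hP, fun Q hQ => ?_, fun Q hQ hQmin => ?_, ⟨d, Z⁻¹, hd, inv_pos.2 hZ0, hPd⟩, ?_⟩
  · rcases eq_or_ne Q P with rfl | h
    · exact le_rfl
    · exact (hmin Q hQ h).le
  · by_contra h
    exact (hmin Q hQ h).not_ge (hQmin P hP)
  · rintro Q hQ ⟨d', lam, hd', hlam, hQd⟩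
    by_contra h
    exact lt_asymm (hmin Q hQ h)
      (entMMCObj_lt_of_scaling hη hd' hlam hQ hP hQd (Ne.symm h))
end

section
/- Let n ≥ 1. The normalized circulation polytope {P ∈ Δ_{n×n} : Σ_j P_ij = Σ_j P_ji for all i} equals the convex hull of the set of normalized cycle matrices {P_σ : σ a cycle on [n]}. -/
/-- The normalized cycle matrix of a cycle given by `k` distinct vertices `v 0, …, v (k-1)`
traversed cyclically: entry `1/k` on each edge `(v t, v (t+1 mod k))` and `0` elsewhere. -/
noncomputable def cycleMatrix (n k : ℕ) (hk : 0 < k) (v : Fin k → Fin n) :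
    Matrix (Fin n) (Fin n) ℝ :=
  fun i j => (k : ℝ)⁻¹ *
    ((Finset.univ.filter
      (fun t : Fin k => v t = i ∧ v ⟨(t.val + 1) % k, Nat.mod_lt _ hk⟩ = j)).card : ℝ)

/-- The set of normalized cycle matrices `P_σ` over all cycles `σ` on `[n]`. -/
noncomputable def cycleMatrices (n : ℕ) : Set (Matrix (Fin n) (Fin n) ℝ) :=
  {P | ∃ (k : ℕ) (hk : 0 < k), k ≤ n ∧
    ∃ v : Fin k → Fin n, Function.Injective v ∧ P = cycleMatrix n k hk v}

theorem cyclicSucc_bijective (k : ℕ) (hk : 0 < k) :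
    Function.Bijective (fun t : Fin k => (⟨(t.val + 1) % k, Nat.mod_lt _ hk⟩ : Fin k)) := by
  rw [← Finite.injective_iff_bijective]
  intro a b hab
  have h : a.val + 1 ≡ b.val + 1 [MOD k] := congrArg Fin.val hab
  exact Fin.ext ((Nat.ModEq.add_right_cancel' 1 h).eq_of_lt_of_lt a.isLt b.isLt)

theorem cycleMatrix_apply_eq_sum (n k : ℕ) (hk : 0 < k) (v : Fin k → Fin n) (i j : Fin n) :
    cycleMatrix n k hk v i j = (k : ℝ)⁻¹ * ∑ t : Fin k,
      if v t = i then if v ⟨(t.val + 1) % k, Nat.mod_lt _ hk⟩ = j then 1 else 0 else 0 := by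
  simp only [cycleMatrix, Finset.card_filter, ite_and, Nat.cast_sum, Nat.cast_ite, Nat.cast_one,
    Nat.cast_zero]

theorem sum_cycleMatrix_row (n k : ℕ) (hk : 0 < k) (v : Fin k → Fin n) (i : Fin n) :
    ∑ j, cycleMatrix n k hk v i j = (k : ℝ)⁻¹ * ∑ t : Fin k, if v t = i then 1 else 0 := by
  simp only [cycleMatrix_apply_eq_sum]
  rw [← Finset.mul_sum, Finset.sum_comm]
  congr 1
  refine Finset.sum_congr rfl fun t _ => ?_
  split_ifs <;> simp

theorem sum_cycleMatrix_col (n k : ℕ) (hk : 0 < k) (v : Fin k → Fin n) (j : Fin n) :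
    ∑ i, cycleMatrix n k hk v i j = (k : ℝ)⁻¹ * ∑ t : Fin k, if v t = j then 1 else 0 := by
  simp only [cycleMatrix_apply_eq_sum]
  rw [← Finset.mul_sum, Finset.sum_comm,
    ← (cyclicSucc_bijective k hk).sum_comp (fun t => if v t = j then (1 : ℝ) else 0)]
  congr 1
  refine Finset.sum_congr rfl fun t _ => ?_
  simp

theorem cycleMatrix_mem_circulationPolytope (n k : ℕ) (hk : 0 < k) (v : Fin k → Fin n) :
    cycleMatrix n k hk v ∈ circulationPolytope n := by
  refine ⟨fun i j => ?_, ?_, fun i => ?_⟩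
  · unfold cycleMatrix
    positivity
  · simp only [sum_cycleMatrix_row]
    rw [← Finset.mul_sum, Finset.sum_comm]
    have : (k : ℝ) ≠ 0 := by positivity
    simp [this]
  · rw [sum_cycleMatrix_row, sum_cycleMatrix_col]

theorem convex_circulationPolytope (n : ℕ) : Convex ℝ (circulationPolytope n) := by
  rintro P ⟨hP0, hP1, hP2⟩ Q ⟨hQ0, hQ1, hQ2⟩ a b ha hb hab
  refine ⟨fun i j => ?_, ?_, fun i => ?_⟩
  · have := hP0 i j
    have := hQ0 i j
    simp only [Matrix.add_apply, Matrix.smul_apply, smul_eq_mul]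
    positivity
  · simp only [Matrix.add_apply, Matrix.smul_apply, smul_eq_mul, Finset.sum_add_distrib,
      ← Finset.mul_sum, hP1, hQ1, mul_one, hab]
  · simp only [Matrix.add_apply, Matrix.smul_apply, smul_eq_mul, Finset.sum_add_distrib,
      ← Finset.mul_sum, hP2 i, hQ2 i]

theorem convexHull_cycleMatrices_subset (n : ℕ) :
    convexHull ℝ (cycleMatrices n) ⊆ circulationPolytope n := by
  refine convexHull_min ?_ (convex_circulationPolytope n)
  rintro _ ⟨k, hk, _, v, _, rfl⟩
  exact cycleMatrix_mem_circulationPolytope n k hk v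

/-- The support of a nonzero nonnegative circulation contains a cycle. -/
theorem exists_cycle_of_circulation {n : ℕ} {A : Matrix (Fin n) (Fin n) ℝ}
    (hA : ∀ i j, 0 ≤ A i j) (hbal : ∀ i, ∑ j, A i j = ∑ j, A j i) (hne : A ≠ 0) :
    ∃ (k : ℕ) (hk : 0 < k), k ≤ n ∧ ∃ v : Fin k → Fin n, Function.Injective v ∧
      ∀ t : Fin k, 0 < A (v t) (v ⟨(t.val + 1) % k, Nat.mod_lt _ hk⟩) := by
  have hstep : ∀ i j, 0 < A i j → ∃ l, 0 < A j l := by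
    intro i j hij
    have h : 0 < ∑ l, A j l := by
      rw [hbal j]
      exact Finset.sum_pos' (fun l _ => hA l j) ⟨i, Finset.mem_univ i, hij⟩
    by_contra! hcon
    exact absurd h (Finset.sum_nonpos fun l _ => hcon l).not_gt
  obtain ⟨x, y, hxy⟩ : ∃ x y, 0 < A x y := by
    by_contra! hcon
    exact hne (Matrix.ext fun i j => le_antisymm (hcon i j) (hA i j))
  have hchoice : ∀ i, ∃ j, (∃ l, 0 < A i l) → 0 < A i j := by
    intro i
    by_cases h : ∃ l, 0 < A i l
    · exact ⟨h.choose, fun _ => h.choose_spec⟩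
    · exact ⟨i, fun h' => absurd h' h⟩
  choose f hf using hchoice
  have horbit : ∀ t : ℕ, ∃ l, 0 < A (f^[t] x) l := by
    intro t
    induction t with
    | zero => exact ⟨y, hxy⟩
    | succ t ih =>
      rw [Function.iterate_succ_apply']
      exact hstep _ _ (hf _ ih)
  obtain ⟨a, b, hab, heq⟩ : ∃ a b : ℕ, a < b ∧ f^[a] x = f^[b] x := by
    obtain ⟨a, b, hab, heq⟩ := Finite.exists_ne_map_eq_of_infinite (fun t : ℕ => f^[t] x)
    rcases hab.lt_or_gt with h | h
    · exact ⟨a, b, h, heq⟩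
    · exact ⟨b, a, h, heq.symm⟩
  set z := f^[a] x with hz
  have hper : z ∈ Function.periodicPts f := by
    refine Function.mk_mem_periodicPts (Nat.sub_pos_of_lt hab) ?_
    rw [Function.IsPeriodicPt, Function.IsFixedPt, hz, ← Function.iterate_add_apply,
      Nat.sub_add_cancel hab.le, ← heq]
  have hk := Function.minimalPeriod_pos_of_mem_periodicPts hper
  have hinj : Function.Injective
      (fun t : Fin (Function.minimalPeriod f z) => f^[t.val] z) := fun s t hst =>
    Fin.ext (Function.iterate_injOn_Iio_minimalPeriod s.isLt t.isLt hst)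
  refine ⟨_, hk, by simpa using Fintype.card_le_of_injective _ hinj, _, hinj, fun t => ?_⟩
  simp only [Function.iterate_mod_minimalPeriod_eq]
  rw [Function.iterate_succ_apply']
  apply hf
  have h := horbit (t.val + a)
  rwa [Function.iterate_add_apply] at h

/-- Every nonzero nonnegative circulation is a positive multiple of a convex combination of
cycle matrices. -/
theorem exists_pos_smul_mem_convexHull_cycleMatrices {n : ℕ} (A : Matrix (Fin n) (Fin n) ℝ)
    (hA : ∀ i j, 0 ≤ A i j) (hbal : ∀ i, ∑ j, A i j = ∑ j, A j i) (hne : A ≠ 0) :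
    ∃ s : ℝ, 0 < s ∧ ∃ Q ∈ convexHull ℝ (cycleMatrices n), A = s • Q := by
  induction hN : (Finset.univ.filter fun p : Fin n × Fin n => A p.1 p.2 ≠ 0).card
    using Nat.strong_induction_on generalizing A with
  | _ N ih =>
  obtain ⟨k, hk, hkn, v, hv, hpos⟩ := exists_cycle_of_circulation hA hbal hne
  set next : Fin k → Fin k := fun t => ⟨(t.val + 1) % k, Nat.mod_lt _ hk⟩ with hnext
  have : Nonempty (Fin k) := ⟨⟨0, hk⟩⟩
  obtain ⟨t₀, ht₀⟩ := Finite.exists_min fun t => A (v t) (v (next t))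
  set m := A (v t₀) (v (next t₀)) with hm
  have hm_pos : 0 < m := hpos t₀
  have hk_pos : (0 : ℝ) < k := by positivity
  set C := cycleMatrix n k hk v with hC
  have hC_mem : C ∈ convexHull ℝ (cycleMatrices n) :=
    subset_convexHull ℝ _ ⟨k, hk, hkn, v, hv, rfl⟩
  have hedge : ∀ t, (m * k) * C (v t) (v (next t)) = m := by
    intro t
    have h : C (v t) (v (next t)) = (k : ℝ)⁻¹ := by
      rw [hC, cycleMatrix_apply_eq_sum, Finset.sum_eq_single t]
      · simp [hnext]
      · intro s _ hs
        rw [if_neg (hv.ne hs)]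
      · simp
    rw [h]
    field_simp
  have hnonedge : ∀ i j, (¬ ∃ t, v t = i ∧ v (next t) = j) → C i j = 0 := by
    intro i j h
    push Not at h
    rw [hC, cycleMatrix_apply_eq_sum, Finset.sum_eq_zero, mul_zero]
    intro t _
    split_ifs with h₁ h₂
    · exact absurd h₂ (h t h₁)
    · rfl
    · rfl
  set B := A - (m * k) • C with hB
  have hB_apply : ∀ i j, B i j = A i j - (m * k) * C i j := fun i j => rfl
  have hB_nonneg : ∀ i j, 0 ≤ B i j := by
    intro i j
    rw [hB_apply]
    by_cases h : ∃ t, v t = i ∧ v (next t) = j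
    · obtain ⟨t, rfl, rfl⟩ := h
      rw [hedge]
      exact sub_nonneg.2 (ht₀ t)
    · rw [hnonedge i j h, mul_zero, sub_zero]
      exact hA i j
  have hB_bal : ∀ i, ∑ j, B i j = ∑ j, B j i := by
    intro i
    simp only [hB_apply, Finset.sum_sub_distrib, ← Finset.mul_sum, hbal i,
      (cycleMatrix_mem_circulationPolytope n k hk v).2.2 i, hC]
  have hA_eq : A = B + (m * k) • C := (sub_add_cancel _ _).symm
  by_cases hB0 : B = 0
  · exact ⟨m * k, by positivity, C, hC_mem, by rw [hA_eq, hB0, zero_add]⟩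
  have hcard : (Finset.univ.filter fun p : Fin n × Fin n => B p.1 p.2 ≠ 0).card < N := by
    rw [← hN]
    apply Finset.card_lt_card
    rw [Finset.ssubset_iff_of_subset]
    · refine ⟨(v t₀, v (next t₀)), ?_, ?_⟩
      · simpa using hm_pos.ne'
      · simp [hB_apply, hedge, ← hm]
    · intro p
      simp only [Finset.mem_filter, Finset.mem_univ, true_and]
      intro hp hAp
      refine hp (le_antisymm ?_ (hB_nonneg _ _))
      rw [hB_apply, hAp, zero_sub, Left.neg_nonpos_iff]
      have := (cycleMatrix_mem_circulationPolytope n k hk v).1 p.1 p.2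
      positivity
  obtain ⟨s, hs, Q, hQ, hBQ⟩ := ih _ hcard B hB_nonneg hB_bal hB0 rfl
  have hsm : 0 < s + m * k := by positivity
  refine ⟨s + m * k, hsm, (s / (s + m * k)) • Q + (m * k / (s + m * k)) • C,
    convex_convexHull ℝ _ hQ hC_mem (by positivity) (by positivity)
      (by rw [← add_div, div_self hsm.ne']), ?_⟩
  rw [smul_add, smul_smul, smul_smul, mul_div_cancel₀ _ hsm.ne', mul_div_cancel₀ _ hsm.ne',
    ← hBQ, ← hA_eq]

/-- **Circulation Decomposition Theorem** (normalized form): the normalized circulation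
polytope equals the convex hull of the set of normalized cycle matrices. -/
theorem circulationPolytope_eq_convexHull_cycleMatrices (n : ℕ) (hn : 1 ≤ n) :
    circulationPolytope n = convexHull ℝ (cycleMatrices n) := by
  refine Set.Subset.antisymm ?_ (convexHull_cycleMatrices_subset n)
  rintro P ⟨hP0, hP1, hP2⟩
  have hne : P ≠ 0 := by
    rintro rfl
    simp at hP1
  obtain ⟨s, _, Q, hQ, rfl⟩ := exists_pos_smul_mem_convexHull_cycleMatrices P hP0 hP2 hne
  have hs : s = 1 := by
    simpa only [Matrix.smul_apply, smul_eq_mul, ← Finset.mul_sum,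
      (convexHull_cycleMatrices_subset n hQ).2.1, mul_one] using hP1
  rwa [hs, one_smul]
end

section
/- Let n ≥ 1 and C ∈ ℝ^{n×n}. Then the minimum of the linear function P ↦ Σ_{ij} C_ij P_ij over the normalized circulation polytope {P ∈ Δ_{n×n} : Σ_j P_ij = Σ_j P_ji for all i} is attained and equals the minimum over all cycles σ on [n] of the mean cost (1/|σ|) Σ_{e ∈ σ} C_e, where the sum is over the edges e of σ and |σ| is the length of σ. In other words, the LP relaxation of the Minimum Mean Cycle problem is exact. -/
/-- The mean cost of the cycle with `k` distinct vertices `v 0, …, v (k-1)` traversed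
cyclically, with respect to edge costs `C`. -/
noncomputable def meanCycleCost (n k : ℕ) (hk : 0 < k) (v : Fin k → Fin n)
    (C : Matrix (Fin n) (Fin n) ℝ) : ℝ :=
  (k : ℝ)⁻¹ * ∑ t : Fin k, C (v t) (v ⟨(t.val + 1) % k, Nat.mod_lt _ hk⟩)

section CycleFlow

variable {ι V : Type*} [Fintype ι] [DecidableEq V]

/-- The number of times the closed walks `t ↦ v t`, with successor permutation `σ` on the index
type, traverse each edge. -/
def cycleFlow (σ : Equiv.Perm ι) (v : ι → V) : Matrix V V ℝ :=
  fun i j => ∑ t, if v t = i ∧ v (σ t) = j then 1 else 0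

lemma cycleFlow_nonneg (σ : Equiv.Perm ι) (v : ι → V) (i j : V) : 0 ≤ cycleFlow σ v i j :=
  Finset.sum_nonneg fun t _ => by split_ifs <;> norm_num

lemma cycleFlow_eq_zero {σ : Equiv.Perm ι} {v : ι → V} {i j : V}
    (h : ∀ t, ¬ (v t = i ∧ v (σ t) = j)) : cycleFlow σ v i j = 0 :=
  Finset.sum_eq_zero fun t _ => if_neg (h t)

lemma cycleFlow_apply_edge (σ : Equiv.Perm ι) {v : ι → V} (hv : Function.Injective v) (t : ι) :
    cycleFlow σ v (v t) (v (σ t)) = 1 := by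
  classical
  rw [cycleFlow, Finset.sum_eq_single t]
  · simp
  · intro s _ hs
    exact if_neg fun h => hs (hv h.1)
  · simp

variable [Fintype V]

lemma sum_mul_cycleFlow (σ : Equiv.Perm ι) (v : ι → V) (F : Matrix V V ℝ) :
    ∑ i, ∑ j, F i j * cycleFlow σ v i j = ∑ t, F (v t) (v (σ t)) := by
  simp only [cycleFlow, Finset.mul_sum]
  rw [Finset.sum_congr rfl fun i _ => Finset.sum_comm, Finset.sum_comm]
  refine Finset.sum_congr rfl fun t _ => ?_
  simp [ite_and, Finset.sum_ite_irrel]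

lemma sum_cycleFlow (σ : Equiv.Perm ι) (v : ι → V) :
    ∑ i, ∑ j, cycleFlow σ v i j = Fintype.card ι := by
  simpa using sum_mul_cycleFlow σ v (fun _ _ => 1)

lemma cycleFlow_row_sum_eq_col_sum (σ : Equiv.Perm ι) (v : ι → V) (i : V) :
    ∑ j, cycleFlow σ v i j = ∑ j, cycleFlow σ v j i := by
  simp only [cycleFlow]
  rw [Finset.sum_comm, Finset.sum_comm (γ := V)]
  simp only [ite_and, Finset.sum_ite_irrel, Finset.sum_ite_eq, Finset.mem_univ, if_true,
    Finset.sum_const_zero]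
  exact (Equiv.sum_comp σ fun t => if v t = i then (1 : ℝ) else 0).symm

end CycleFlow

lemma finRotate_eq_mod {k : ℕ} (hk : 0 < k) (t : Fin k) :
    finRotate k t = ⟨(t.val + 1) % k, Nat.mod_lt _ hk⟩ := by
  obtain ⟨k, rfl⟩ := Nat.exists_eq_succ_of_ne_zero hk.ne'
  rw [finRotate_apply]
  ext
  simp [Fin.val_add]

lemma meanCycleCost_eq_sum_finRotate {n k : ℕ} (hk : 0 < k) (v : Fin k → Fin n)
    (C : Matrix (Fin n) (Fin n) ℝ) :
    meanCycleCost n k hk v C = (k : ℝ)⁻¹ * ∑ t, C (v t) (v (finRotate k t)) := by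
  simp only [meanCycleCost, finRotate_eq_mod hk]

/-- A self-map of a nonempty finite type has a cycle. -/
lemma exists_injective_cycle {α : Type*} [Finite α] [Nonempty α] (f : α → α) :
    ∃ k, 0 < k ∧ ∃ v : Fin k → α, Function.Injective v ∧ ∀ t, v (finRotate k t) = f (v t) := by
  obtain ⟨a⟩ := ‹Nonempty α›
  obtain ⟨p, q, hne, heq⟩ := Finite.exists_ne_map_eq_of_infinite fun m : ℕ => f^[m] a
  wlog hlt : p < q generalizing p q
  · exact this q p hne.symm heq.symm (by omega)
  set x := f^[p] a with hx
  have hper : x ∈ Function.periodicPts f := by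
    refine ⟨q - p, by omega, ?_⟩
    change f^[q - p] x = x
    rw [hx, ← Function.iterate_add_apply, Nat.sub_add_cancel hlt.le]
    exact heq.symm
  have hk := Function.minimalPeriod_pos_of_mem_periodicPts hper
  refine ⟨_, hk, fun t => f^[t.val] x, ?_, ?_⟩
  · intro s t hst
    exact Fin.ext (Function.iterate_injOn_Iio_minimalPeriod s.2 t.2 hst)
  · intro t
    rw [finRotate_eq_mod hk]
    simp only [Function.iterate_mod_minimalPeriod_eq, Function.iterate_succ_apply']

/-- The support of a nonzero nonnegative circulation contains a cycle. -/
lemma exists_cycle_of_circulation_s6 {V : Type*} [Fintype V] {P : Matrix V V ℝ}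
    (hP : ∀ i j, 0 ≤ P i j) (hcirc : ∀ i, ∑ j, P i j = ∑ j, P j i) (hne : ∃ i j, P i j ≠ 0) :
    ∃ k, 0 < k ∧ ∃ v : Fin k → V, Function.Injective v ∧
      ∀ t, 0 < P (v t) (v (finRotate k t)) := by
  let S := {i : V // ∃ j, 0 < P i j}
  have hnext : ∀ i : S, ∃ j : S, 0 < P i j := by
    rintro ⟨i, j, hij⟩
    have hpos : 0 < ∑ l, P j l := by
      rw [hcirc]
      exact Finset.sum_pos' (fun l _ => hP l j) ⟨i, Finset.mem_univ i, hij⟩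
    obtain ⟨l, -, hl⟩ := Finset.exists_lt_of_sum_lt (f := fun _ => (0 : ℝ)) (by simpa using hpos)
    exact ⟨⟨j, l, hl⟩, hij⟩
  choose f hf using hnext
  obtain ⟨i, j, hij⟩ := hne
  have : Nonempty S := ⟨⟨i, j, (hP i j).lt_of_ne' hij⟩⟩
  obtain ⟨k, hk, v, hv, hvf⟩ := exists_injective_cycle f
  refine ⟨k, hk, fun t => (v t).1, Subtype.val_injective.comp hv, fun t => ?_⟩
  have h := hf (v t)
  rwa [← hvf t] at h

/-- A lower bound on the mean cost of every cycle bounds the cost of every nonnegative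
circulation. -/
lemma mul_sum_le_of_circulation {V : Type*} [Fintype V] {C : Matrix V V ℝ} {m : ℝ}
    (hm : ∀ (k : ℕ) (v : Fin k → V), Function.Injective v →
      m * k ≤ ∑ t, C (v t) (v (finRotate k t)))
    (P : Matrix V V ℝ) (hP : ∀ i j, 0 ≤ P i j) (hcirc : ∀ i, ∑ j, P i j = ∑ j, P j i) :
    m * ∑ i, ∑ j, P i j ≤ ∑ i, ∑ j, C i j * P i j := by
  classical
  induction hN : (Finset.univ.filter fun e : V × V => P e.1 e.2 ≠ 0).card
    using Nat.strong_induction_on generalizing P with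
  | _ N ih =>
    by_cases hne : ∃ i j, P i j ≠ 0
    swap
    · push Not at hne
      simp [hne]
    obtain ⟨k, hk, v, hv, hpos⟩ := exists_cycle_of_circulation_s6 hP hcirc hne
    have : Nonempty (Fin k) := ⟨⟨0, hk⟩⟩
    obtain ⟨s, hs⟩ := Finite.exists_min fun t => P (v t) (v (finRotate k t))
    set ε := P (v s) (v (finRotate k s)) with hε
    set Q := cycleFlow (finRotate k) v with hQ
    have hQcases : ∀ i j, Q i j = 0 ∨ (Q i j = 1 ∧ ε ≤ P i j) := by
      intro i j
      by_cases h : ∃ t, v t = i ∧ v (finRotate k t) = j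
      · obtain ⟨t, rfl, rfl⟩ := h
        exact .inr ⟨cycleFlow_apply_edge _ hv t, hs t⟩
      · exact .inl (cycleFlow_eq_zero (not_exists.mp h))
    have hεpos : 0 < ε := hpos s
    have key := ih _ ?_ (fun i j => P i j - ε * Q i j) ?_ ?_ rfl
    · have hC : ∑ i, ∑ j, C i j * (P i j - ε * Q i j)
          = ∑ i, ∑ j, C i j * P i j - ε * ∑ t, C (v t) (v (finRotate k t)) := by
        rw [← sum_mul_cycleFlow]
        simp only [mul_sub, Finset.sum_sub_distrib, Finset.mul_sum, mul_left_comm, hQ]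
      have h1 : ∑ i, ∑ j, (P i j - ε * Q i j) = ∑ i, ∑ j, P i j - ε * k := by
        have := sum_cycleFlow (finRotate k) v
        rw [Fintype.card_fin] at this
        rw [← this]
        simp only [Finset.sum_sub_distrib, Finset.mul_sum, hQ]
      rw [hC, h1] at key
      nlinarith [mul_le_mul_of_nonneg_left (hm k v hv) hεpos.le]
    · rw [← hN]
      refine Finset.card_lt_card (Finset.ssubset_iff_of_subset ?_ |>.mpr ?_)
      · rintro ⟨i, j⟩ h
        simp only [Finset.mem_filter, Finset.mem_univ, true_and] at h ⊢
        rcases hQcases i j with h0 | ⟨-, hle⟩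
        · simpa [h0] using h
        · exact (hεpos.trans_le hle).ne'
      · refine ⟨(v s, v (finRotate k s)), ?_, ?_⟩
        · simpa only [Finset.mem_filter, Finset.mem_univ, true_and] using hεpos.ne'
        · simp only [hQ, cycleFlow_apply_edge _ hv, Finset.mem_filter, mul_one, hε, sub_self,
            ne_eq, not_true_eq_false, and_false, not_false_eq_true]
    · intro i j
      rcases hQcases i j with h0 | ⟨h1, hle⟩
      · simpa [h0] using hP i j
      · simpa [h1] using hle
    · intro i
      simp only [Finset.sum_sub_distrib, ← Finset.mul_sum, hcirc i, hQ,
        cycleFlow_row_sum_eq_col_sum _ v i]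

lemma meanCycleCost_mem_circulationPolytope_values {n k : ℕ} (hk : 0 < k) (v : Fin k → Fin n)
    (C : Matrix (Fin n) (Fin n) ℝ) :
    ∃ P ∈ circulationPolytope n, meanCycleCost n k hk v C = ∑ i, ∑ j, C i j * P i j := by
  have hk' : (k : ℝ) ≠ 0 := Nat.cast_ne_zero.mpr hk.ne'
  refine ⟨fun i j => (k : ℝ)⁻¹ * cycleFlow (finRotate k) v i j, ⟨fun i j => ?_, ?_, fun i => ?_⟩, ?_⟩
  · exact mul_nonneg (by positivity) (cycleFlow_nonneg _ _ _ _)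
  · simp only [← Finset.mul_sum, sum_cycleFlow, Fintype.card_fin]
    exact inv_mul_cancel₀ hk'
  · simp only [← Finset.mul_sum, cycleFlow_row_sum_eq_col_sum _ v i]
  · rw [meanCycleCost_eq_sum_finRotate, ← sum_mul_cycleFlow]
    simp only [Finset.mul_sum, mul_left_comm]

lemma exists_isLeast_meanCycleCost (n : ℕ) (hn : 1 ≤ n) (C : Matrix (Fin n) (Fin n) ℝ) :
    ∃ m : ℝ, IsLeast {r : ℝ | ∃ (k : ℕ) (hk : 0 < k), k ≤ n ∧
      ∃ v : Fin k → Fin n, Function.Injective v ∧ r = meanCycleCost n k hk v C} m := by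
  set T := {r : ℝ | ∃ (k : ℕ) (hk : 0 < k), k ≤ n ∧
      ∃ v : Fin k → Fin n, Function.Injective v ∧ r = meanCycleCost n k hk v C}
  have hfin : T.Finite := by
    refine (Set.finite_range fun x : Σ k : Fin n, (Fin (k.val + 1) → Fin n) =>
      meanCycleCost n _ (Nat.succ_pos _) x.2 C).subset ?_
    rintro r ⟨k, hk, hkn, v, -, rfl⟩
    obtain ⟨k, rfl⟩ := Nat.exists_eq_succ_of_ne_zero hk.ne'
    exact ⟨⟨⟨k, hkn⟩, v⟩, rfl⟩
  have hne : T.Nonempty :=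
    ⟨_, 1, one_pos, hn, fun _ => ⟨0, hn⟩, Function.injective_of_subsingleton _, rfl⟩
  obtain ⟨m, hmT, hm⟩ := T.exists_min_image id hfin hne
  exact ⟨m, hmT, hm⟩

/-- **Exactness of the LP relaxation of Minimum Mean Cycle.** The minimum of `⟨C, P⟩` over
the normalized circulation polytope is attained and equals the minimum mean cost over all
cycles on `[n]`. -/
theorem mmc_lp_relaxation_exact (n : ℕ) (hn : 1 ≤ n) (C : Matrix (Fin n) (Fin n) ℝ) :
    ∃ m : ℝ,
      IsLeast {r : ℝ | ∃ P ∈ circulationPolytope n, r = ∑ i, ∑ j, C i j * P i j} m ∧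
      IsLeast {r : ℝ | ∃ (k : ℕ) (hk : 0 < k), k ≤ n ∧
        ∃ v : Fin k → Fin n, Function.Injective v ∧ r = meanCycleCost n k hk v C} m := by
  obtain ⟨m, ⟨k, hk, hkn, v, hv, rfl⟩, hm⟩ := exists_isLeast_meanCycleCost n hn C
  refine ⟨_, ⟨meanCycleCost_mem_circulationPolytope_values hk v C, ?_⟩,
    ⟨k, hk, hkn, v, hv, rfl⟩, hm⟩
  rintro r ⟨P, ⟨hP, hsum, hcirc⟩, rfl⟩
  have h := mul_sum_le_of_circulation (C := C) (m := meanCycleCost n k hk v C) ?_ P hP hcirc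
  · rwa [hsum, mul_one] at h
  intro l w hw
  rcases Nat.eq_zero_or_pos l with rfl | hl
  · simp
  have hln : l ≤ n := by simpa using Fintype.card_le_of_injective w hw
  have hl' : (0 : ℝ) < l := Nat.cast_pos.mpr hl
  have hle := hm ⟨l, hl, hln, w, hw, rfl⟩
  rwa [meanCycleCost_eq_sum_finRotate hl, inv_mul_eq_div, le_div_iff₀ hl'] at hle
end

section
/- Let n ≥ 1 and C ∈ ℝ^{n×n}. Then the minimum mean cycle value min over cycles σ on [n] of (1/|σ|) Σ_{e ∈ σ} C_e equals the supremum over x ∈ ℝ^n of min_{i,j ∈ [n]} (C_ij + x_i - x_j), and this supremum is attained. -/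
/-- Along a cyclic traversal, the potential differences cancel, so any uniform lower bound for
the reduced costs `C i j + x i - x j` bounds the mean cost of every cycle from below. -/
theorem le_meanCycleCost_of_forall_le {n k : ℕ} (hk : 0 < k) (v : Fin k → Fin n)
    (C : Matrix (Fin n) (Fin n) ℝ) (x : Fin n → ℝ) {a : ℝ}
    (h : ∀ i j, a ≤ C i j + x i - x j) : a ≤ meanCycleCost n k hk v C := by
  obtain ⟨d, rfl⟩ : ∃ d, k = d + 1 := ⟨k - 1, by omega⟩
  have hshift : ∀ t : Fin (d + 1),
      (⟨(t.val + 1) % (d + 1), Nat.mod_lt _ hk⟩ : Fin (d + 1)) = t + 1 := by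
    intro t
    ext
    simp [Fin.val_add]
  have hcancel : ∑ t : Fin (d + 1), x (v (t + 1)) = ∑ t : Fin (d + 1), x (v t) :=
    Equiv.sum_comp (Equiv.addRight (1 : Fin (d + 1))) (fun t => x (v t))
  have hsum : ∑ _t : Fin (d + 1), a ≤
      ∑ t : Fin (d + 1), (C (v t) (v (t + 1)) + x (v t) - x (v (t + 1))) :=
    Finset.sum_le_sum fun t _ => h _ _
  rw [Finset.sum_sub_distrib, Finset.sum_add_distrib, hcancel, add_sub_cancel_right,
    Finset.sum_const, Finset.card_univ, Fintype.card_fin, nsmul_eq_mul] at hsum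
  simp only [meanCycleCost, hshift]
  rwa [le_inv_mul_iff₀ (by positivity)]

/-- The mean cost of a cycle given by the first `d + 1` terms of a sequence. -/
theorem meanCycleCost_of_seq {n : ℕ} (d : ℕ) (q : ℕ → Fin n) (C : Matrix (Fin n) (Fin n) ℝ) :
    meanCycleCost n (d + 1) d.succ_pos (fun t => q t) C =
      ((d + 1 : ℕ) : ℝ)⁻¹ * (∑ t ∈ Finset.range d, C (q t) (q (t + 1)) + C (q d) (q 0)) := by
  rw [meanCycleCost, Fin.sum_univ_castSucc, ← Fin.sum_univ_eq_sum_range]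
  congr 2
  · refine Finset.sum_congr rfl fun t _ => ?_
    have ht : (t.val + 1) % (d + 1) = t.val + 1 := Nat.mod_eq_of_lt (by omega)
    simp [ht]
  · simp

/-- The values of the mean cost over all cycles form a finite set. -/
theorem finite_setOf_meanCycleCost (n : ℕ) (C : Matrix (Fin n) (Fin n) ℝ) :
    {r : ℝ | ∃ (k : ℕ) (hk : 0 < k), k ≤ n ∧
      ∃ v : Fin k → Fin n, Function.Injective v ∧ r = meanCycleCost n k hk v C}.Finite := by
  refine (Set.finite_range fun p : Σ k : Fin n, Fin (k.val + 1) → Fin n =>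
    meanCycleCost n (p.1.val + 1) p.1.val.succ_pos p.2 C).subset ?_
  rintro r ⟨k, hk, hkn, v, -, rfl⟩
  obtain ⟨d, rfl⟩ : ∃ d, k = d + 1 := ⟨k - 1, by omega⟩
  exact ⟨⟨⟨d, hkn⟩, v⟩, rfl⟩

/-- The costs of the simple paths ending at `j`. -/
def simplePathCosts {n : ℕ} (D : Matrix (Fin n) (Fin n) ℝ) (j : Fin n) : Set ℝ :=
  {w | ∃ (l : ℕ) (p : ℕ → Fin n), Set.InjOn p (Set.Iic l) ∧ p l = j ∧
    w = ∑ t ∈ Finset.range l, D (p t) (p (t + 1))}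

theorem lt_of_injOn_Iic {n l : ℕ} {p : ℕ → Fin n} (hp : Set.InjOn p (Set.Iic l)) : l < n := by
  have h := Fintype.card_le_of_injective (fun t : Fin (l + 1) => p t) fun a b hab =>
    Fin.ext (hp (Set.mem_Iic.2 (by omega)) (Set.mem_Iic.2 (by omega)) hab)
  simp only [Fintype.card_fin] at h
  omega

theorem simplePathCosts_nonempty {n : ℕ} (D : Matrix (Fin n) (Fin n) ℝ) (j : Fin n) :
    (simplePathCosts D j).Nonempty := by
  refine ⟨0, 0, fun _ => j, ?_, rfl, by simp⟩
  intro a ha b hb _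
  simp only [Set.mem_Iic] at ha hb
  omega

theorem bddBelow_simplePathCosts {n : ℕ} (D : Matrix (Fin n) (Fin n) ℝ) (j : Fin n) :
    BddBelow (simplePathCosts D j) := by
  have hB : ∀ i k, |D i k| ≤ ∑ i, ∑ k, |D i k| := fun i k =>
    (Finset.single_le_sum (f := fun k => |D i k|) (fun _ _ => abs_nonneg _)
      (Finset.mem_univ k)).trans
    (Finset.single_le_sum (f := fun i => ∑ k, |D i k|)
      (fun _ _ => Finset.sum_nonneg fun _ _ => abs_nonneg _) (Finset.mem_univ i))
  have hB0 : 0 ≤ ∑ i, ∑ k, |D i k| :=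
    Finset.sum_nonneg fun _ _ => Finset.sum_nonneg fun _ _ => abs_nonneg _
  set B := ∑ i, ∑ k, |D i k|
  refine ⟨-(n * B), ?_⟩
  rintro w ⟨l, p, hp, -, rfl⟩
  have hl : (l : ℝ) ≤ n := by exact_mod_cast (lt_of_injOn_Iic hp).le
  have hsum : ∑ _t ∈ Finset.range l, (-B) ≤ ∑ t ∈ Finset.range l, D (p t) (p (t + 1)) :=
    Finset.sum_le_sum fun t _ => neg_le_of_abs_le (hB _ _)
  rw [Finset.sum_const, Finset.card_range, nsmul_eq_mul] at hsum
  nlinarith [mul_le_mul_of_nonneg_right hl hB0]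

/-- If there are no simple cycles of negative cost, then the shortest simple path costs form a
feasible potential. -/
theorem exists_potential {n : ℕ} (D : Matrix (Fin n) (Fin n) ℝ)
    (hD : ∀ (d : ℕ) (q : ℕ → Fin n), Set.InjOn q (Set.Iic d) →
      0 ≤ ∑ t ∈ Finset.range d, D (q t) (q (t + 1)) + D (q d) (q 0)) :
    ∃ x : Fin n → ℝ, ∀ i j, 0 ≤ D i j + x i - x j := by
  refine ⟨fun j => sInf (simplePathCosts D j), fun i j => ?_⟩
  suffices h : sInf (simplePathCosts D j) - D i j ≤ sInf (simplePathCosts D i) by linarith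
  refine le_csInf (simplePathCosts_nonempty D i) ?_
  rintro w ⟨l, p, hp, rfl, rfl⟩
  rw [sub_le_iff_le_add]
  by_cases hj : ∃ s ≤ l, p s = j
  · obtain ⟨s, hs, rfl⟩ := hj
    obtain ⟨d, rfl⟩ := Nat.exists_eq_add_of_le hs
    have hle := csInf_le (bddBelow_simplePathCosts D (p s))
      ⟨s, p, hp.mono (Set.Iic_subset_Iic.2 hs), rfl, rfl⟩
    have hcycle := hD d (fun t => p (s + t)) (by
      intro a ha b hb hab
      have := hp (Set.mem_Iic.2 (Nat.add_le_add_left ha s))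
        (Set.mem_Iic.2 (Nat.add_le_add_left hb s)) hab
      omega)
    rw [Finset.sum_range_add]
    simp only [add_zero, ← add_assoc] at hcycle ⊢
    linarith
  · push Not at hj
    refine csInf_le (bddBelow_simplePathCosts D j)
      ⟨l + 1, fun t => if t ≤ l then p t else j, ?_, by simp, ?_⟩
    · intro a ha b hb hab
      simp only [Set.mem_Iic] at ha hb
      dsimp only at hab
      split_ifs at hab with h₁ h₂ h₂
      · exact hp h₁ h₂ hab
      · exact absurd hab (hj a h₁)
      · exact absurd hab.symm (hj b h₂)
      · omega
    · rw [Finset.sum_range_succ]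
      congr 1
      · refine Finset.sum_congr rfl fun t ht => ?_
        have ht := Finset.mem_range.1 ht
        simp only [if_pos ht.le, if_pos (Nat.succ_le_of_lt ht)]
      · simp

/-- **Minimum Mean Cycle duality.** The minimum mean cycle value of `C` equals
`sup_{x ∈ ℝⁿ} min_{i,j} (C i j + x i - x j)`, and both the minimum over cycles and the
supremum over `x` are attained. -/
theorem mmc_duality (n : ℕ) (hn : 1 ≤ n) (C : Matrix (Fin n) (Fin n) ℝ) :
    ∃ m : ℝ,
      IsLeast {r : ℝ | ∃ (k : ℕ) (hk : 0 < k), k ≤ n ∧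
        ∃ v : Fin k → Fin n, Function.Injective v ∧ r = meanCycleCost n k hk v C} m ∧
      IsGreatest {r : ℝ | ∃ x : Fin n → ℝ, r = ⨅ i, ⨅ j, (C i j + x i - x j)} m := by
  obtain ⟨m, hm⟩ : ∃ m, IsLeast {r : ℝ | ∃ (k : ℕ) (hk : 0 < k), k ≤ n ∧
      ∃ v : Fin k → Fin n, Function.Injective v ∧ r = meanCycleCost n k hk v C} m :=
    let ⟨m, hm, hle⟩ := Set.exists_min_image _ id (finite_setOf_meanCycleCost n C)
      ⟨_, 1, one_pos, hn, fun _ => ⟨0, hn⟩, Function.injective_of_subsingleton _, rfl⟩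
    ⟨m, hm, hle⟩
  have hinf : ∀ (x : Fin n → ℝ) i j,
      (⨅ i, ⨅ j, (C i j + x i - x j)) ≤ C i j + x i - x j := fun x i j =>
    (ciInf_le (Set.finite_range _).bddBelow i).trans (ciInf_le (Set.finite_range _).bddBelow j)
  have hupper : ∀ x : Fin n → ℝ, (⨅ i, ⨅ j, (C i j + x i - x j)) ≤ m := by
    intro x
    obtain ⟨k, hk, -, v, -, rfl⟩ := hm.1
    exact le_meanCycleCost_of_forall_le hk v C x (hinf x)
  refine ⟨m, hm, ?_, ?_⟩
  · obtain ⟨x, hx⟩ := exists_potential (Matrix.of fun i j => C i j - m) (by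
      intro d q hq
      have hle := hm.2 ⟨d + 1, d.succ_pos, lt_of_injOn_Iic hq, fun t => q t,
        fun a b hab => Fin.ext (hq (Set.mem_Iic.2 (by omega)) (Set.mem_Iic.2 (by omega)) hab),
        rfl⟩
      rw [meanCycleCost_of_seq, le_inv_mul_iff₀ (by positivity)] at hle
      push_cast at hle
      simp only [Matrix.of_apply]
      rw [Finset.sum_sub_distrib, Finset.sum_const, Finset.card_range, nsmul_eq_mul]
      linarith)
    have : Nonempty (Fin n) := ⟨⟨0, hn⟩⟩
    refine ⟨x, le_antisymm (le_ciInf fun i => le_ciInf fun j => ?_) (hupper x)⟩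
    have hij := hx i j
    simp only [Matrix.of_apply] at hij
    linarith
  · rintro r ⟨x, rfl⟩
    exact hupper x
end

section
/- Let n ≥ 1, C ∈ ℝ^{n×n}, and μ, ν ∈ Δ_n. Then the Optimal Transport value min over P ∈ U(μ,ν) of Σ_{ij} C_ij P_ij equals the supremum over x, y ∈ ℝ^n of [ min_{i,j ∈ [n]} (C_ij - x_i - y_j) + Σ_i μ_i x_i + Σ_j ν_j y_j ], and this supremum is attained. -/
open Finset in
/-- The linear map sending a plan `p` to its cost and its two marginals. -/
noncomputable def costMarginals {ι κ : Type*} [Fintype ι] [Fintype κ] (C : ι → κ → ℝ) :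
    (ι × κ → ℝ) →ₗ[ℝ] ℝ × (ι → ℝ) × (κ → ℝ) where
  toFun p := (∑ i, ∑ j, C i j * p (i, j), fun i => ∑ j, p (i, j), fun j => ∑ i, p (i, j))
  map_add' p q := by
    ext <;> simp [mul_add, sum_add_distrib]
  map_smul' c p := by
    ext <;> simp [mul_sum, mul_left_comm]

section Duality

variable {ι κ : Type*} [Fintype ι] [Fintype κ]

lemma StrongDual.apply_prod_pi [DecidableEq ι] [DecidableEq κ]
    (f : StrongDual ℝ (ℝ × (ι → ℝ) × (κ → ℝ))) (t : ℝ) (a : ι → ℝ) (b : κ → ℝ) :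
    f (t, a, b) = t * f (1, 0, 0) + ∑ i, a i * f (0, Pi.single i 1, 0) +
      ∑ j, b j * f (0, 0, Pi.single j 1) := by
  have h : (t, a, b) = t • ((1 : ℝ), (0 : ι → ℝ), (0 : κ → ℝ)) +
      ∑ i, a i • ((0 : ℝ), (Pi.single i 1 : ι → ℝ), (0 : κ → ℝ)) +
      ∑ j, b j • ((0 : ℝ), (0 : ι → ℝ), (Pi.single j 1 : κ → ℝ)) := by
    ext <;> simp [Prod.fst_sum, Prod.snd_sum, Finset.sum_apply, Pi.single_apply]
  rw [h]
  simp only [map_add, map_sum, map_smul, smul_eq_mul]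

lemma costMarginals_single [DecidableEq ι] [DecidableEq κ] (C : ι → κ → ℝ) (i : ι) (j : κ) :
    costMarginals C (Pi.single (i, j) 1) = (C i j, Pi.single i 1, Pi.single j 1) := by
  ext <;> simp [costMarginals, Pi.single_apply, Prod.ext_iff, ite_and, eq_comm]

/-- A plan of minimal cost exists among those with prescribed marginals. -/
lemma exists_isMinOn_cost (C : ι → κ → ℝ) {μ : ι → ℝ} {ν : κ → ℝ}
    (hμpos : ∀ i, 0 ≤ μ i) (hμsum : ∑ i, μ i = 1)
    (hνpos : ∀ j, 0 ≤ ν j) (hνsum : ∑ j, ν j = 1) :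
    ∃ p ∈ stdSimplex ℝ (ι × κ), (costMarginals C p).2 = (μ, ν) ∧
      ∀ q ∈ stdSimplex ℝ (ι × κ), (costMarginals C q).2 = (μ, ν) →
        (costMarginals C p).1 ≤ (costMarginals C q).1 := by
  have hc : Continuous (costMarginals C) := LinearMap.continuous_of_finiteDimensional _
  have hK : IsCompact (stdSimplex ℝ (ι × κ) ∩ {p | (costMarginals C p).2 = (μ, ν)}) :=
    (isCompact_stdSimplex ℝ (ι × κ)).inter_right (isClosed_eq hc.snd continuous_const)
  have hne : (stdSimplex ℝ (ι × κ) ∩ {p | (costMarginals C p).2 = (μ, ν)}).Nonempty := by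
    refine ⟨fun p => μ p.1 * ν p.2, ⟨fun p => mul_nonneg (hμpos _) (hνpos _), ?_⟩, ?_⟩
    · simp [Fintype.sum_prod_type, ← Finset.mul_sum, hμsum, hνsum]
    · simp [costMarginals, ← Finset.mul_sum, ← Finset.sum_mul, hμsum, hνsum]
  obtain ⟨p, ⟨hp, hpm⟩, hmin⟩ := hK.exists_isMinOn hne hc.fst.continuousOn
  exact ⟨p, hp, hpm, fun q hq hqm => hmin ⟨hq, hqm⟩⟩

/-- Any value below the optimal transport cost is exceeded by a feasible pair of potentials. -/
lemma exists_potentials_gt (C : ι → κ → ℝ) {μ : ι → ℝ} {ν : κ → ℝ}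
    (hμsum : ∑ i, μ i = 1) {p : ι × κ → ℝ} (hp : p ∈ stdSimplex ℝ (ι × κ))
    (hpm : (costMarginals C p).2 = (μ, ν))
    (hmin : ∀ q ∈ stdSimplex ℝ (ι × κ), (costMarginals C q).2 = (μ, ν) →
      (costMarginals C p).1 ≤ (costMarginals C q).1) {r : ℝ} (hr : r < (costMarginals C p).1) :
    ∃ (x : ι → ℝ) (y : κ → ℝ), (∀ i j, x i + y j ≤ C i j) ∧
      r ≤ ∑ i, μ i * x i + ∑ j, ν j * y j := by
  classical
  have hc : Continuous (costMarginals C) := LinearMap.continuous_of_finiteDimensional _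
  have hnot : (r, μ, ν) ∉ costMarginals C '' stdSimplex ℝ (ι × κ) := by
    rintro ⟨q, hq, hqr⟩
    have := hmin q hq (by rw [hqr])
    rw [hqr] at this
    exact absurd this (not_le.2 hr)
  obtain ⟨f, u, hu, hf⟩ := geometric_hahn_banach_point_closed
    ((convex_stdSimplex ℝ (ι × κ)).linear_image (costMarginals C))
    ((isCompact_stdSimplex ℝ (ι × κ)).image hc).isClosed hnot
  have hsep : ∀ q ∈ stdSimplex ℝ (ι × κ), f (r, μ, ν) < f (costMarginals C q) :=
    fun q hq => hu.trans (hf _ ⟨q, hq, rfl⟩)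
  set a := f (1, 0, 0) with ha
  set X : ι → ℝ := fun i => f (0, Pi.single i 1, 0) with hX
  set Y : κ → ℝ := fun j => f (0, 0, Pi.single j 1) with hY
  set S := ∑ i, μ i * X i with hS
  set T := ∑ j, ν j * Y j with hT
  have hr' : f (r, μ, ν) = r * a + S + T := f.apply_prod_pi r μ ν
  have hapos : 0 < a := by
    have h := hsep p hp
    rw [← Prod.mk.eta (p := costMarginals C p), hpm, hr', f.apply_prod_pi] at h
    change _ < _ * a + S + T at h
    nlinarith
  have hv : ∀ i j, r * a + S + T < C i j * a + X i + Y j := by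
    intro i j
    have h := hsep _ (single_mem_stdSimplex ℝ (i, j))
    rw [costMarginals_single, hr', f.apply_prod_pi] at h
    simpa [Pi.single_apply] using h
  refine ⟨fun i => (r * a + S + T - X i) / a, fun j => - Y j / a, fun i j => ?_, ?_⟩
  · rw [← add_div, div_le_iff₀ hapos]
    linarith [hv i j]
  · have h1 : ∑ i, μ i * ((r * a + S + T - X i) / a) = (r * a + S + T - S) / a := by
      simp only [mul_div_assoc', ← Finset.sum_div, mul_sub, Finset.sum_sub_distrib,
        ← Finset.sum_mul, hμsum, one_mul, hS]
    have h2 : ∑ j, ν j * (- Y j / a) = - T / a := by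
      simp only [mul_div_assoc', ← Finset.sum_div, mul_neg, Finset.sum_neg_distrib, hT]
    rw [h1, h2, ← add_div, le_div_iff₀ hapos]
    linarith

/-- Feasible potentials can be replaced by uniformly bounded ones without decreasing the dual
objective. -/
lemma exists_bounded_potentials [Nonempty ι] [Nonempty κ] (C : ι → κ → ℝ) {M : ℝ}
    (hM : ∀ i j, |C i j| ≤ M) {μ : ι → ℝ} {ν : κ → ℝ}
    (hμpos : ∀ i, 0 ≤ μ i) (hμsum : ∑ i, μ i = 1)
    (hνpos : ∀ j, 0 ≤ ν j) (hνsum : ∑ j, ν j = 1)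
    {x : ι → ℝ} {y : κ → ℝ} (h : ∀ i j, x i + y j ≤ C i j) :
    ∃ (x' : ι → ℝ) (y' : κ → ℝ), (∀ i j, x' i + y' j ≤ C i j) ∧
      (∀ i, |x' i| ≤ 2 * M) ∧ (∀ j, |y' j| ≤ 3 * M) ∧
      ∑ i, μ i * x i + ∑ j, ν j * y j ≤ ∑ i, μ i * x' i + ∑ j, ν j * y' j := by
  obtain ⟨i₀⟩ := ‹Nonempty ι›
  have : Nonempty ι := ⟨i₀⟩
  choose σ hσ using fun i => Finite.exists_min fun j => C i j - y j
  set u : ι → ℝ := fun i => C i (σ i) - y (σ i) with hu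
  choose τ hτ using fun j => Finite.exists_min fun i => C i j - u i
  have hxu : ∀ i, x i ≤ u i := fun i => by linarith [h i (σ i)]
  have hyv : ∀ j, y j ≤ C (τ j) j - u (τ j) := fun j => by linarith [hσ (τ j) j]
  have hosc : ∀ i k, u i ≤ u k + 2 * M := fun i k => by
    have h1 := abs_le.1 (hM i (σ k))
    have h2 := abs_le.1 (hM k (σ k))
    have h3 : u k = C k (σ k) - y (σ k) := rfl
    linarith [hσ i (σ k)]
  refine ⟨fun i => u i - u i₀, fun j => C (τ j) j - u (τ j) + u i₀, fun i j => ?_, fun i => ?_,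
    fun j => ?_, ?_⟩
  · linarith [hτ j i]
  · rw [abs_le]
    constructor <;> linarith [hosc i i₀, hosc i₀ i]
  · have h1 := abs_le.1 (hM (τ j) j)
    rw [abs_le]
    constructor <;> linarith [hosc (τ j) i₀, hosc i₀ (τ j)]
  · have h1 : ∑ i, μ i * x i ≤ ∑ i, μ i * u i :=
      Finset.sum_le_sum fun i _ => mul_le_mul_of_nonneg_left (hxu i) (hμpos i)
    have h2 : ∑ j, ν j * y j ≤ ∑ j, ν j * (C (τ j) j - u (τ j)) :=
      Finset.sum_le_sum fun j _ => mul_le_mul_of_nonneg_left (hyv j) (hνpos j)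
    have h3 : ∑ i, μ i * (u i - u i₀) = ∑ i, μ i * u i - u i₀ := by
      simp only [mul_sub, Finset.sum_sub_distrib, ← Finset.sum_mul, hμsum, one_mul]
    have h4 : ∑ j, ν j * (C (τ j) j - u (τ j) + u i₀) =
        ∑ j, ν j * (C (τ j) j - u (τ j)) + u i₀ := by
      simp only [mul_add, Finset.sum_add_distrib, ← Finset.sum_mul, hνsum, one_mul]
    linarith

/-- If feasible potentials come arbitrarily close to a dual value, that value is attained. -/
lemma exists_potentials_ge [Nonempty ι] [Nonempty κ] (C : ι → κ → ℝ) {μ : ι → ℝ} {ν : κ → ℝ}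
    (hμpos : ∀ i, 0 ≤ μ i) (hμsum : ∑ i, μ i = 1)
    (hνpos : ∀ j, 0 ≤ ν j) (hνsum : ∑ j, ν j = 1) {m : ℝ}
    (hm : ∀ r < m, ∃ (x : ι → ℝ) (y : κ → ℝ), (∀ i j, x i + y j ≤ C i j) ∧
      r ≤ ∑ i, μ i * x i + ∑ j, ν j * y j) :
    ∃ (x : ι → ℝ) (y : κ → ℝ), (∀ i j, x i + y j ≤ C i j) ∧
      m ≤ ∑ i, μ i * x i + ∑ j, ν j * y j := by
  obtain ⟨⟨i₀, j₀⟩, hM⟩ := Finite.exists_max fun p : ι × κ => |C p.1 p.2|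
  set M := |C i₀ j₀|
  have hb := fun {x y} => exists_bounded_potentials (x := x) (y := y) C
    (fun i j => hM (i, j)) hμpos hμsum hνpos hνsum
  let K : Set ((ι → ℝ) × (κ → ℝ)) :=
    (Set.univ.pi (fun _ => Set.Icc (-(2 * M)) (2 * M)) ×ˢ
      Set.univ.pi (fun _ => Set.Icc (-(3 * M)) (3 * M))) ∩ {z | ∀ i j, z.1 i + z.2 j ≤ C i j}
  have hK : IsCompact K := by
    refine ((isCompact_univ_pi fun _ => isCompact_Icc).prod
      (isCompact_univ_pi fun _ => isCompact_Icc)).inter_right ?_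
    simp only [Set.ofPred_forall]
    exact isClosed_iInter fun i => isClosed_iInter fun j =>
      isClosed_le (by fun_prop) continuous_const
  have hge : ∀ r < m, ∃ z ∈ K, r ≤ ∑ i, μ i * z.1 i + ∑ j, ν j * z.2 j := by
    intro r hr
    obtain ⟨x, y, hxy, hr⟩ := hm r hr
    obtain ⟨x', y', hxy', hx, hy, hle⟩ := hb hxy
    exact ⟨(x', y'), ⟨⟨fun i _ => abs_le.1 (hx i), fun j _ => abs_le.1 (hy j)⟩, hxy'⟩,
      hr.trans hle⟩
  obtain ⟨z₀, hz₀, -⟩ := hge (m - 1) (by linarith)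
  obtain ⟨z, hz, hmax⟩ := hK.exists_isMaxOn ⟨z₀, hz₀⟩
    (f := fun z => ∑ i, μ i * z.1 i + ∑ j, ν j * z.2 j) (by fun_prop)
  refine ⟨z.1, z.2, hz.2, le_of_forall_lt_imp_le_of_dense fun r hr => ?_⟩
  obtain ⟨w, hw, hrw⟩ := hge r hr
  exact hrw.trans (hmax hw)

/-- Weak duality. -/
lemma iInf_add_le_cost [Nonempty ι] [Nonempty κ] (C P : ι → κ → ℝ) {μ : ι → ℝ} {ν : κ → ℝ}
    (hP : ∀ i j, 0 ≤ P i j) (hsum : ∑ i, ∑ j, P i j = 1) (hμ : ∀ i, ∑ j, P i j = μ i)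
    (hν : ∀ j, ∑ i, P i j = ν j) (x : ι → ℝ) (y : κ → ℝ) :
    (⨅ i, ⨅ j, (C i j - x i - y j)) + ∑ i, μ i * x i + ∑ j, ν j * y j ≤
      ∑ i, ∑ j, C i j * P i j := by
  set t := ⨅ i, ⨅ j, (C i j - x i - y j)
  have ht : ∀ i j, t ≤ C i j - x i - y j := fun i j =>
    (ciInf_le (Set.finite_range _).bddBelow i).trans (ciInf_le (Set.finite_range _).bddBelow j)
  have h1 : ∑ i, μ i * x i = ∑ i, ∑ j, x i * P i j := by
    simp only [← hμ, Finset.sum_mul, mul_comm (x _)]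
  have h2 : ∑ j, ν j * y j = ∑ i, ∑ j, y j * P i j := by
    rw [Finset.sum_comm]
    simp only [← hν, Finset.sum_mul, mul_comm (y _)]
  have h3 : t = ∑ i, ∑ j, t * P i j := by
    simp only [← Finset.mul_sum, hsum, mul_one]
  rw [h1, h2, h3]
  simp only [← Finset.sum_add_distrib, ← add_mul]
  exact Finset.sum_le_sum fun i _ => Finset.sum_le_sum fun j _ =>
    mul_le_mul_of_nonneg_right (by linarith [ht i j]) (hP i j)

end Duality

/-- **Optimal Transport LP duality.** The OT value `min_{P ∈ U(μ,ν)} ⟨C, P⟩` equals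
`sup_{x,y ∈ ℝⁿ} [min_{i,j} (C i j - x i - y j) + ⟨μ, x⟩ + ⟨ν, y⟩]`, and both the minimum
and the supremum are attained. -/
theorem ot_duality (n : ℕ) (hn : 1 ≤ n) (C : Matrix (Fin n) (Fin n) ℝ)
    (μ ν : Fin n → ℝ)
    (hμpos : ∀ i, 0 ≤ μ i) (hμsum : ∑ i, μ i = 1)
    (hνpos : ∀ j, 0 ≤ ν j) (hνsum : ∑ j, ν j = 1) :
    ∃ m : ℝ,
      IsLeast {r : ℝ | ∃ P ∈ transportPolytope n μ ν, r = ∑ i, ∑ j, C i j * P i j} m ∧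
      IsGreatest {r : ℝ | ∃ x y : Fin n → ℝ,
        r = (⨅ i, ⨅ j, (C i j - x i - y j)) + (∑ i, μ i * x i) + (∑ j, ν j * y j)} m := by
  have : Nonempty (Fin n) := ⟨⟨0, hn⟩⟩
  obtain ⟨p, hp, hpm, hmin⟩ := exists_isMinOn_cost C hμpos hμsum hνpos hνsum
  obtain ⟨x, y, hxy, hle⟩ := exists_potentials_ge C hμpos hμsum hνpos hνsum
    fun r hr => exists_potentials_gt C hμsum hp hpm hmin hr
  have hpU : (fun i j => p (i, j)) ∈ transportPolytope n μ ν :=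
    ⟨fun i j => hp.1 (i, j), by rw [← hp.2, Fintype.sum_prod_type],
      fun i => congrFun (congrArg Prod.fst hpm) i, fun j => congrFun (congrArg Prod.snd hpm) j⟩
  have hweak : ∀ x y : Fin n → ℝ, (⨅ i, ⨅ j, (C i j - x i - y j)) + (∑ i, μ i * x i) +
      (∑ j, ν j * y j) ≤ (costMarginals C p).1 :=
    iInf_add_le_cost C _ hpU.1 hpU.2.1 hpU.2.2.1 hpU.2.2.2
  refine ⟨(costMarginals C p).1, ⟨⟨_, hpU, rfl⟩, ?_⟩, ⟨x, y, le_antisymm ?_ (hweak x y)⟩, ?_⟩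
  · rintro _ ⟨Q, ⟨hQ, hQsum, hQμ, hQν⟩, rfl⟩
    exact hmin (fun q => Q q.1 q.2)
      ⟨fun q => hQ q.1 q.2, by rw [← hQsum, Fintype.sum_prod_type]⟩
      (Prod.ext (funext hQμ) (funext hQν))
  · have h0 : 0 ≤ ⨅ i, ⨅ j, (C i j - x i - y j) :=
      le_ciInf fun i => le_ciInf fun j => by linarith [hxy i j]
    linarith
  · rintro _ ⟨x', y', rfl⟩
    exact hweak x' y'
end

section
/- Let n ≥ 1, η > 0, and C ∈ ℝ^{n×n}. Then the entropically regularized Minimum Mean Cycle value min over P in the normalized circulation polytope of [Σ_{ij} C_ij P_ij + η^{-1} Σ_{ij} P_ij log P_ij] equals the supremum over x ∈ ℝ^n of [ -η^{-1} log Σ_{ij} exp(-η(C_ij + x_i - x_j)) ], and this supremum is attained. -/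
/-- The partition function of the dual problem, as a function of the potential `x`. -/
noncomputable def mmcPartition {ι : Type*} [Fintype ι] (η : ℝ) (C : Matrix ι ι ℝ) (x : ι → ℝ) : ℝ :=
  ∑ i, ∑ j, Real.exp (-η * (C i j + x i - x j))

section

variable {ι : Type*} [Fintype ι] {η : ℝ} {C : Matrix ι ι ℝ}

lemma exp_le_mmcPartition (x : ι → ℝ) (i j : ι) :
    Real.exp (-η * (C i j + x i - x j)) ≤ mmcPartition η C x :=
  (Finset.single_le_sum (f := fun j => Real.exp (-η * (C i j + x i - x j)))
      (fun _ _ => (Real.exp_pos _).le) (Finset.mem_univ j)).trans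
    (Finset.single_le_sum (f := fun i => ∑ j, Real.exp (-η * (C i j + x i - x j)))
      (fun _ _ => Finset.sum_nonneg fun _ _ => (Real.exp_pos _).le) (Finset.mem_univ i))

lemma mmcPartition_pos [Nonempty ι] (x : ι → ℝ) : 0 < mmcPartition η C x :=
  Finset.sum_pos (fun _ _ => Finset.sum_pos (fun _ _ => Real.exp_pos _) Finset.univ_nonempty)
    Finset.univ_nonempty

lemma mmcPartition_sub_const (x : ι → ℝ) (c : ℝ) :
    mmcPartition η C (fun i => x i - c) = mmcPartition η C x := by
  unfold mmcPartition
  refine Finset.sum_congr rfl fun i _ => Finset.sum_congr rfl fun j _ => ?_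
  congr 1
  ring

lemma sub_le_of_mmcPartition_le [Nonempty ι] (hη : 0 < η) {x : ι → ℝ} {B : ℝ}
    (h : mmcPartition η C x ≤ B) (i j : ι) :
    x j - x i ≤ (∑ i, ∑ j, |C i j|) + |Real.log B| / η := by
  have hlog : -η * (C i j + x i - x j) ≤ Real.log B :=
    (Real.le_log_iff_exp_le ((mmcPartition_pos x).trans_le h)).2 ((exp_le_mmcPartition x i j).trans h)
  have hC : |C i j| ≤ ∑ i, ∑ j, |C i j| :=
    (Finset.single_le_sum (f := fun j => |C i j|) (fun _ _ => abs_nonneg _)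
      (Finset.mem_univ j)).trans
    (Finset.single_le_sum (f := fun i => ∑ j, |C i j|)
      (fun _ _ => Finset.sum_nonneg fun _ _ => abs_nonneg _) (Finset.mem_univ i))
  have hdiv : x j - x i - C i j ≤ |Real.log B| / η := by
    rw [le_div_iff₀ hη]
    linarith [le_abs_self (Real.log B)]
  linarith [le_abs_self (C i j)]

lemma exists_forall_mmcPartition_le [Nonempty ι] (hη : 0 < η) :
    ∃ y : ι → ℝ, ∀ x, mmcPartition η C y ≤ mmcPartition η C x := by
  obtain ⟨o⟩ := ‹Nonempty ι›
  set K := (∑ i, ∑ j, |C i j|) + |Real.log (mmcPartition η C 0)| / η with hK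
  have hK0 : 0 ≤ K := by positivity
  have hcont : Continuous (mmcPartition η C) := by
    unfold mmcPartition
    fun_prop
  obtain ⟨y, -, hy⟩ := (isCompact_Icc (a := fun _ : ι => -K) (b := fun _ => K)).exists_isMinOn
    ⟨0, fun _ => neg_nonpos.2 hK0, fun _ => hK0⟩ hcont.continuousOn
  refine ⟨y, fun x => ?_⟩
  rcases le_total (mmcPartition η C x) (mmcPartition η C 0) with h | h
  · rw [← mmcPartition_sub_const x (x o)]
    refine hy ⟨fun i => ?_, fun i => sub_le_of_mmcPartition_le hη h o i⟩
    have := sub_le_of_mmcPartition_le hη h i o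
    change -K ≤ x i - x o
    linarith
  · exact (hy ⟨fun _ => neg_nonpos.2 hK0, fun _ => hK0⟩ :
      mmcPartition η C y ≤ mmcPartition η C 0).trans h

/-- Stationarity at a minimizer: row and column sums of the Gibbs weights agree. -/
lemma sum_exp_row_eq_col_of_isMin (hη : 0 < η) {y : ι → ℝ}
    (hy : ∀ x, mmcPartition η C y ≤ mmcPartition η C x) (k : ι) :
    ∑ j, Real.exp (-η * (C k j + y k - y j)) = ∑ j, Real.exp (-η * (C j k + y j - y k)) := by
  classical
  let e : ι → ℝ := Pi.single k 1
  have hd : HasDerivAt (fun t : ℝ => mmcPartition η C (fun i => y i + t * e i))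
      (∑ i, ∑ j, Real.exp (-η * (C i j + y i - y j)) * (-η * (e i - e j))) 0 := by
    unfold mmcPartition
    refine HasDerivAt.fun_sum fun i _ => HasDerivAt.fun_sum fun j _ => ?_
    have hlin : HasDerivAt (fun t : ℝ => -η * (C i j + (y i + t * e i) - (y j + t * e j)))
        (-η * (e i - e j)) 0 := by
      have h1 : ∀ c : ι, HasDerivAt (fun t : ℝ => y c + t * e c) (e c) 0 := fun c => by
        simpa using ((hasDerivAt_id (0 : ℝ)).mul_const (e c)).const_add (y c)
      exact (((h1 i).const_add (C i j)).sub (h1 j)).const_mul (-η)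
    simpa using hlin.exp
  have hmin : IsLocalMin (fun t : ℝ => mmcPartition η C (fun i => y i + t * e i)) 0 :=
    Filter.Eventually.of_forall fun t => by simpa using hy _
  have h0 := hmin.hasDerivAt_eq_zero hd
  have hsplit : (∑ i, ∑ j, Real.exp (-η * (C i j + y i - y j)) * (-η * (e i - e j))) =
      -η * (∑ i, ∑ j, Real.exp (-η * (C i j + y i - y j)) * e i -
        ∑ i, ∑ j, Real.exp (-η * (C i j + y i - y j)) * e j) := by
    simp only [← Finset.sum_sub_distrib, Finset.mul_sum]
    refine Finset.sum_congr rfl fun i _ => Finset.sum_congr rfl fun j _ => ?_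
    ring
  rw [hsplit, mul_eq_zero, or_iff_right (neg_ne_zero.2 hη.ne'), sub_eq_zero] at h0
  simpa [e, Pi.single_apply, ← Finset.sum_mul] using h0

/-- Potential differences integrate to zero against a matrix with equal row and column sums. -/
lemma sum_mul_potential_sub_eq_zero {P : Matrix ι ι ℝ} (hP : ∀ i, ∑ j, P i j = ∑ j, P j i)
    (x : ι → ℝ) : ∑ i, ∑ j, P i j * (x i - x j) = 0 := by
  simp only [mul_sub, Finset.sum_sub_distrib, ← Finset.sum_mul]
  rw [Finset.sum_comm (f := fun i j => P i j * x j)]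
  simp only [← Finset.sum_mul, hP, sub_self]

end

lemma mul_log_add_sub_le_mul_log {p q : ℝ} (hp : 0 ≤ p) (hq : 0 < q) :
    p * Real.log q + p - q ≤ p * Real.log p := by
  rcases hp.eq_or_lt with rfl | hp
  · simpa using hq.le
  · have h := mul_le_mul_of_nonneg_left (Real.log_le_sub_one_of_pos (div_pos hq hp)) hp.le
    rw [Real.log_div hq.ne' hp.ne', mul_sub, mul_sub, mul_div_cancel₀ _ hp.ne'] at h
    linarith

/-- The Gibbs distribution associated with a potential `x`. -/
noncomputable def mmcGibbs {ι : Type*} [Fintype ι] (η : ℝ) (C : Matrix ι ι ℝ) (x : ι → ℝ) :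
    Matrix ι ι ℝ :=
  fun i j => Real.exp (-η * (C i j + x i - x j)) / mmcPartition η C x

section

variable {ι : Type*} [Fintype ι] [Nonempty ι] {η : ℝ} {C : Matrix ι ι ℝ}

lemma mmcGibbs_pos (x : ι → ℝ) (i j : ι) : 0 < mmcGibbs η C x i j :=
  div_pos (Real.exp_pos _) (mmcPartition_pos x)

lemma sum_mmcGibbs (x : ι → ℝ) : ∑ i, ∑ j, mmcGibbs η C x i j = 1 := by
  simp only [mmcGibbs, ← Finset.sum_div]
  exact div_self (mmcPartition_pos x).ne'

lemma log_mmcGibbs (x : ι → ℝ) (i j : ι) :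
    Real.log (mmcGibbs η C x i j) =
      -η * (C i j + x i - x j) - Real.log (mmcPartition η C x) := by
  rw [mmcGibbs, Real.log_div (Real.exp_pos _).ne' (mmcPartition_pos x).ne', Real.log_exp]

end

/-- The linear cost of a circulation plus its scaled cross-entropy relative to a Gibbs
distribution is the dual value. -/
lemma cost_add_crossEntropy_mmcGibbs {n : ℕ} [Nonempty (Fin n)] {η : ℝ} (hη : 0 < η)
    {C P : Matrix (Fin n) (Fin n) ℝ} (hP : P ∈ circulationPolytope n) (x : Fin n → ℝ) :
    (∑ i, ∑ j, C i j * P i j) + η⁻¹ * ∑ i, ∑ j, P i j * Real.log (mmcGibbs η C x i j) =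
      -η⁻¹ * Real.log (mmcPartition η C x) := by
  have hterm : ∀ i j, P i j * Real.log (mmcGibbs η C x i j) =
      -η * (C i j * P i j) + -η * (P i j * (x i - x j)) -
        P i j * Real.log (mmcPartition η C x) := fun i j => by
    rw [log_mmcGibbs]
    ring
  simp only [hterm, Finset.sum_sub_distrib, Finset.sum_add_distrib, ← Finset.mul_sum,
    ← Finset.sum_mul, sum_mul_potential_sub_eq_zero hP.2.2 x, hP.2.1]
  field_simp
  ring

lemma dual_le_entMMCObj {n : ℕ} [Nonempty (Fin n)] {η : ℝ} (hη : 0 < η)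
    {C P : Matrix (Fin n) (Fin n) ℝ} (hP : P ∈ circulationPolytope n) (x : Fin n → ℝ) :
    -η⁻¹ * Real.log (mmcPartition η C x) ≤ entMMCObj n η C P := by
  rw [← cost_add_crossEntropy_mmcGibbs hη hP x, entMMCObj]
  have h : ∑ i, ∑ j, (P i j * Real.log (mmcGibbs η C x i j) + P i j - mmcGibbs η C x i j) ≤
      ∑ i, ∑ j, P i j * Real.log (P i j) :=
    Finset.sum_le_sum fun i _ => Finset.sum_le_sum fun j _ =>
      mul_log_add_sub_le_mul_log (hP.1 i j) (mmcGibbs_pos x i j)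
  simp only [Finset.sum_sub_distrib, Finset.sum_add_distrib, hP.2.1, sum_mmcGibbs] at h
  have := mul_le_mul_of_nonneg_left h (inv_pos.2 hη).le
  linarith

/-- **Entropic Minimum Mean Cycle duality.** The entropic MMC value over the normalized
circulation polytope equals `sup_x [-η⁻¹ log ∑_{ij} exp(-η(C_ij + x_i - x_j))]`, and both
the minimum and the supremum are attained. -/
theorem entropic_mmc_duality (n : ℕ) (hn : 1 ≤ n) (η : ℝ) (hη : 0 < η)
    (C : Matrix (Fin n) (Fin n) ℝ) :
    ∃ m : ℝ,
      IsLeast {r : ℝ | ∃ P ∈ circulationPolytope n, r = entMMCObj n η C P} m ∧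
      IsGreatest {r : ℝ | ∃ x : Fin n → ℝ,
        r = -η⁻¹ * Real.log (∑ i, ∑ j, Real.exp (-η * (C i j + x i - x j)))} m := by
  have : Nonempty (Fin n) := ⟨⟨0, hn⟩⟩
  obtain ⟨y, hy⟩ := exists_forall_mmcPartition_le (C := C) hη
  have hQ : mmcGibbs η C y ∈ circulationPolytope n := by
    refine ⟨fun i j => (mmcGibbs_pos y i j).le, sum_mmcGibbs y, fun i => ?_⟩
    simp only [mmcGibbs, ← Finset.sum_div]
    rw [sum_exp_row_eq_col_of_isMin hη hy i]
  have hval : -η⁻¹ * Real.log (mmcPartition η C y) = entMMCObj n η C (mmcGibbs η C y) :=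
    (cost_add_crossEntropy_mmcGibbs hη hQ y).symm
  refine ⟨-η⁻¹ * Real.log (mmcPartition η C y), ⟨⟨_, hQ, hval⟩, ?_⟩, ⟨y, rfl⟩, ?_⟩
  · rintro _ ⟨P, hP, rfl⟩
    exact dual_le_entMMCObj hη hP y
  · rintro _ ⟨x, rfl⟩
    rw [hval]
    exact dual_le_entMMCObj hη hQ x
end

section
/- Let n ≥ 2, η > 0, C ∈ ℝ^{n×n}, and let μ, ν ∈ Δ_n have all entries strictly positive. Let P_η be the unique minimizer over P ∈ U(μ,ν) of Σ_{ij} C_ij P_ij + η^{-1} Σ_{ij} P_ij log P_ij. Then Σ_{ij} C_ij (P_η)_ij ≤ min over P ∈ U(μ,ν) of Σ_{ij} C_ij P_ij + 2 η^{-1} log n. In particular, taking η = 2 ε^{-1} log n, the entropic minimizer solves the Optimal Transport problem to additive accuracy ε. -/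
/-- The Shannon entropy of a probability vector is nonnegative. -/
theorem sum_mul_log_nonpos {ι : Type*} [Fintype ι] {p : ι → ℝ}
    (hp : ∀ i, 0 ≤ p i) (hsum : ∑ i, p i = 1) : ∑ i, p i * Real.log (p i) ≤ 0 :=
  Finset.sum_nonpos fun i _ => Real.mul_log_nonpos (hp i)
    (hsum ▸ Finset.single_le_sum (fun j _ => hp j) (Finset.mem_univ i))

/-- The Shannon entropy of a probability vector is at most the logarithm of the number of
outcomes. -/
theorem neg_log_card_le_sum_mul_log {ι : Type*} [Fintype ι] {p : ι → ℝ}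
    (hp : ∀ i, 0 ≤ p i) (hsum : ∑ i, p i = 1) :
    -Real.log (Fintype.card ι) ≤ ∑ i, p i * Real.log (p i) := by
  have hι : Nonempty ι := by
    by_contra h
    rw [not_nonempty_iff] at h
    simp at hsum
  have hN : (0 : ℝ) < Fintype.card ι := by exact_mod_cast Fintype.card_pos
  have key : ∀ i, p i - (Fintype.card ι : ℝ)⁻¹ - p i * Real.log (Fintype.card ι)
      ≤ p i * Real.log (p i) := by
    intro i
    rcases (hp i).eq_or_lt with h | h
    · simp [← h]
    · have hlog := Real.one_sub_inv_le_log_of_pos (mul_pos hN h)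
      rw [Real.log_mul hN.ne' h.ne'] at hlog
      have hmul := mul_le_mul_of_nonneg_left hlog h.le
      have hinv : p i * (1 - ((Fintype.card ι : ℝ) * p i)⁻¹)
          = p i - (Fintype.card ι : ℝ)⁻¹ := by
        field_simp
      linarith
  have hle := Finset.sum_le_sum fun i (_ : i ∈ Finset.univ) => key i
  have hcard : ∑ _i : ι, (Fintype.card ι : ℝ)⁻¹ = 1 := by simp [hN.ne']
  rw [Finset.sum_sub_distrib, Finset.sum_sub_distrib, ← Finset.sum_mul, hsum, hcard] at hle
  linarith

/-- **Approximation guarantee of entropic OT.** If `P_η` minimizes the entropic OT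
objective over `U(μ,ν)`, then its (unregularized) transport cost is within `2 η⁻¹ log n`
of the optimal OT value. In particular, for `η = 2 ε⁻¹ log n` the entropic minimizer
solves OT to additive accuracy `ε`. -/
theorem entropic_ot_approx (n : ℕ) (hn : 2 ≤ n) (η : ℝ) (hη : 0 < η)
    (C : Matrix (Fin n) (Fin n) ℝ) (μ ν : Fin n → ℝ)
    (hμpos : ∀ i, 0 < μ i) (hμsum : ∑ i, μ i = 1)
    (hνpos : ∀ j, 0 < ν j) (hνsum : ∑ j, ν j = 1)
    (Pη : Matrix (Fin n) (Fin n) ℝ)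
    (hPη : Pη ∈ transportPolytope n μ ν)
    (hPηmin : ∀ Q ∈ transportPolytope n μ ν, entOTObj n η C Pη ≤ entOTObj n η C Q) :
    (∀ Q ∈ transportPolytope n μ ν,
      (∑ i, ∑ j, C i j * Pη i j) ≤ (∑ i, ∑ j, C i j * Q i j) + 2 * η⁻¹ * Real.log n) ∧
    (∀ ε : ℝ, 0 < ε → η = 2 * ε⁻¹ * Real.log n →
      ∀ Q ∈ transportPolytope n μ ν,
        (∑ i, ∑ j, C i j * Pη i j) ≤ (∑ i, ∑ j, C i j * Q i j) + ε) := by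
  have approx : ∀ Q ∈ transportPolytope n μ ν,
      (∑ i, ∑ j, C i j * Pη i j) ≤ (∑ i, ∑ j, C i j * Q i j) + 2 * η⁻¹ * Real.log n := by
    intro Q hQ
    have hmin := hPηmin Q hQ
    unfold entOTObj at hmin
    have hlower := neg_log_card_le_sum_mul_log (p := fun x : Fin n × Fin n => Pη x.1 x.2)
      (fun x => hPη.1 x.1 x.2) (by rw [Fintype.sum_prod_type]; exact hPη.2.1)
    have hupper := sum_mul_log_nonpos (p := fun x : Fin n × Fin n => Q x.1 x.2)
      (fun x => hQ.1 x.1 x.2) (by rw [Fintype.sum_prod_type]; exact hQ.2.1)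
    have hn0 : (n : ℝ) ≠ 0 := by positivity
    rw [Fintype.sum_prod_type, Fintype.card_prod, Fintype.card_fin, Nat.cast_mul,
      Real.log_mul hn0 hn0] at hlower
    rw [Fintype.sum_prod_type] at hupper
    have hη' := (inv_pos.mpr hη).le
    have hlower' := mul_le_mul_of_nonneg_left hlower hη'
    have hupper' := mul_nonpos_of_nonneg_of_nonpos hη' hupper
    linarith
  refine ⟨approx, fun ε hε hηε Q hQ => ?_⟩
  have hlog : 0 < Real.log n := Real.log_pos (by exact_mod_cast hn)
  have hbound : 2 * η⁻¹ * Real.log n = ε := by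
    rw [hηε]
    field_simp
  exact hbound ▸ approx Q hQ
end

section
/- Let n ≥ 1, let K ∈ ℝ^{n×n} have all entries strictly positive, let μ, ν ∈ Δ_n have all entries strictly positive, and define the dual potential Φ(x,y) = log(Σ_{ij} K_ij e^{x_i + y_j}) - Σ_i μ_i x_i - Σ_j ν_j y_j for x, y ∈ ℝ^n. Fix y ∈ ℝ^n. Then x ∈ ℝ^n minimizes Φ(·, y) if and only if the normalized matrix p_ij = K_ij e^{x_i + y_j} / Σ_{kl} K_kl e^{x_k + y_l} has row sums Σ_j p_ij = μ_i for all i. Moreover, such a minimizer exists: namely the Sinkhorn row update x'_i = x_i + log(μ_i / ρ_i), where ρ_i = Σ_j p_ij is the current normalized row marginal, satisfies this condition. (Thus the Sinkhorn row update is an exact block coordinate descent step on the dual potential.) -/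
/-- The dual potential `Φ(x,y) = log ∑_{ij} K_ij e^{x_i + y_j} - ⟨μ,x⟩ - ⟨ν,y⟩`. -/
noncomputable def dualPotential (n : ℕ) (K : Matrix (Fin n) (Fin n) ℝ)
    (μ ν x y : Fin n → ℝ) : ℝ :=
  Real.log (∑ i, ∑ j, K i j * Real.exp (x i + y j))
    - (∑ i, μ i * x i) - (∑ j, ν j * y j)

/-- The `i`-th row marginal of the normalized scaled matrix
`p_ij = K_ij e^{x_i + y_j} / ∑_{kl} K_kl e^{x_k + y_l}`. -/
noncomputable def rowMarginal (n : ℕ) (K : Matrix (Fin n) (Fin n) ℝ)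
    (x y : Fin n → ℝ) (i : Fin n) : ℝ :=
  (∑ j, K i j * Real.exp (x i + y j)) / (∑ k, ∑ l, K k l * Real.exp (x k + y l))

section RowScaling

variable {n : ℕ} {K : Matrix (Fin n) (Fin n) ℝ}

theorem row_sum_pos (hn : 1 ≤ n) (hK : ∀ i j, 0 < K i j) (x y : Fin n → ℝ) (i : Fin n) :
    0 < ∑ j, K i j * Real.exp (x i + y j) :=
  Finset.sum_pos (fun j _ => mul_pos (hK i j) (Real.exp_pos _)) ⟨⟨0, hn⟩, Finset.mem_univ _⟩

theorem total_sum_pos (hn : 1 ≤ n) (hK : ∀ i j, 0 < K i j) (x y : Fin n → ℝ) :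
    0 < ∑ i, ∑ j, K i j * Real.exp (x i + y j) :=
  Finset.sum_pos (fun i _ => row_sum_pos hn hK x y i) ⟨⟨0, hn⟩, Finset.mem_univ _⟩

theorem rowMarginal_pos (hn : 1 ≤ n) (hK : ∀ i j, 0 < K i j) (x y : Fin n → ℝ) (i : Fin n) :
    0 < rowMarginal n K x y i :=
  div_pos (row_sum_pos hn hK x y i) (total_sum_pos hn hK x y)

theorem sum_rowMarginal (hn : 1 ≤ n) (hK : ∀ i j, 0 < K i j) (x y : Fin n → ℝ) :
    ∑ i, rowMarginal n K x y i = 1 := by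
  simp only [rowMarginal]
  rw [← Finset.sum_div, div_self (total_sum_pos hn hK x y).ne']

theorem row_sum_add (hn : 1 ≤ n) (hK : ∀ i j, 0 < K i j) (x d y : Fin n → ℝ) (i : Fin n) :
    ∑ j, K i j * Real.exp (x i + d i + y j) =
      (∑ k, ∑ l, K k l * Real.exp (x k + y l)) *
        (rowMarginal n K x y i * Real.exp (d i)) := by
  rw [rowMarginal, ← mul_assoc, mul_div_cancel₀ _ (total_sum_pos hn hK x y).ne',
    Finset.sum_mul]
  refine Finset.sum_congr rfl fun j _ => ?_
  rw [mul_assoc, ← Real.exp_add]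
  ring_nf

theorem total_sum_add (hn : 1 ≤ n) (hK : ∀ i j, 0 < K i j) (x d y : Fin n → ℝ) :
    ∑ i, ∑ j, K i j * Real.exp (x i + d i + y j) =
      (∑ k, ∑ l, K k l * Real.exp (x k + y l)) *
        ∑ i, rowMarginal n K x y i * Real.exp (d i) := by
  rw [Finset.mul_sum]
  exact Finset.sum_congr rfl fun i _ => row_sum_add hn hK x d y i

theorem rowMarginal_add (hn : 1 ≤ n) (hK : ∀ i j, 0 < K i j) (x d y : Fin n → ℝ) (i : Fin n) :
    rowMarginal n K (fun k => x k + d k) y i =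
      rowMarginal n K x y i * Real.exp (d i) /
        ∑ k, rowMarginal n K x y k * Real.exp (d k) := by
  rw [rowMarginal, row_sum_add hn hK, total_sum_add hn hK,
    mul_div_mul_left _ _ (total_sum_pos hn hK x y).ne']

theorem dualPotential_add (hn : 1 ≤ n) (hK : ∀ i j, 0 < K i j) (μ ν x d y : Fin n → ℝ) :
    dualPotential n K μ ν (fun k => x k + d k) y =
      dualPotential n K μ ν x y +
        (Real.log (∑ i, rowMarginal n K x y i * Real.exp (d i)) - ∑ i, μ i * d i) := by
  have hpos : 0 < ∑ i, rowMarginal n K x y i * Real.exp (d i) :=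
    Finset.sum_pos (fun i _ => mul_pos (rowMarginal_pos hn hK x y i) (Real.exp_pos _))
      ⟨⟨0, hn⟩, Finset.mem_univ _⟩
  simp only [dualPotential]
  rw [total_sum_add hn hK, Real.log_mul (total_sum_pos hn hK x y).ne' hpos.ne']
  simp only [mul_add, Finset.sum_add_distrib]
  ring

theorem rowMarginal_mul_exp_log (hn : 1 ≤ n) (hK : ∀ i j, 0 < K i j) {μ : Fin n → ℝ}
    (hμ : ∀ i, 0 < μ i) (x y : Fin n → ℝ) (i : Fin n) :
    rowMarginal n K x y i * Real.exp (Real.log (μ i / rowMarginal n K x y i)) = μ i := by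
  have hρ := rowMarginal_pos hn hK x y i
  rw [Real.exp_log (div_pos (hμ i) hρ), mul_div_cancel₀ _ hρ.ne']

end RowScaling

/-- The equality case of Gibbs' inequality. -/
theorem eq_of_sum_mul_log_div_nonpos {ι : Type*} [Fintype ι] {p q : ι → ℝ}
    (hp : ∀ i, 0 < p i) (hq : ∀ i, 0 < q i) (hsum : ∑ i, p i = ∑ i, q i)
    (h : ∑ i, p i * Real.log (p i / q i) ≤ 0) : p = q := by
  have hlog : ∀ i, Real.log (p i / q i) = -Real.log (q i / p i) := fun i => by
    rw [← Real.log_inv, inv_div]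
  have hterm : ∀ i, p i * (q i / p i - 1) = q i - p i := fun i => by
    have := (hp i).ne'
    field_simp
  have hnonneg : ∀ i ∈ Finset.univ, 0 ≤ q i - p i + p i * Real.log (p i / q i) := fun i _ => by
    have := mul_le_mul_of_nonneg_left
      (Real.log_le_sub_one_of_pos (div_pos (hq i) (hp i))) (hp i).le
    rw [hterm] at this
    rw [hlog]
    linarith
  have hzero : ∑ i, (q i - p i + p i * Real.log (p i / q i)) = 0 := by
    refine le_antisymm ?_ (Finset.sum_nonneg hnonneg)
    rw [Finset.sum_add_distrib, Finset.sum_sub_distrib]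
    linarith
  funext i
  by_contra hne
  have hlt := mul_lt_mul_of_pos_left
    (Real.log_lt_sub_one_of_pos (div_pos (hq i) (hp i))
      fun h1 => hne ((div_eq_one_iff_eq (hp i).ne').1 h1).symm) (hp i)
  have hi := (Finset.sum_eq_zero_iff_of_nonneg hnonneg).1 hzero i (Finset.mem_univ i)
  rw [hterm] at hlt
  rw [hlog] at hi
  linarith

/-- Jensen's inequality for the exponential, in log-sum-exp form. -/
theorem sum_mul_le_log_sum_mul_exp {ι : Type*} [Fintype ι] {p : ι → ℝ}
    (hp : ∀ i, 0 ≤ p i) (hsum : ∑ i, p i = 1) (d : ι → ℝ) :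
    ∑ i, p i * d i ≤ Real.log (∑ i, p i * Real.exp (d i)) := by
  have h := convexOn_exp.map_sum_le (t := Finset.univ) (p := d)
    (fun i _ => hp i) hsum (fun i _ => Set.mem_univ _)
  simp only [smul_eq_mul] at h
  exact (Real.le_log_iff_exp_le ((Real.exp_pos _).trans_le h)).2 h

/-- **The Sinkhorn row update is exact block coordinate descent.** Fix `y`. Then `x`
minimizes `Φ(·, y)` iff the normalized scaled matrix has row marginals `μ`; moreover,
for any `x`, the Sinkhorn row update `x' i = x i + log (μ i / ρ i)` (where `ρ` is the
current row marginal) satisfies this condition. -/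
theorem sinkhorn_row_update_block_descent
    (n : ℕ) (hn : 1 ≤ n) (K : Matrix (Fin n) (Fin n) ℝ)
    (hK : ∀ i j, 0 < K i j) (μ ν : Fin n → ℝ)
    (hμpos : ∀ i, 0 < μ i) (hμsum : ∑ i, μ i = 1)
    (hνpos : ∀ j, 0 < ν j) (hνsum : ∑ j, ν j = 1)
    (y : Fin n → ℝ) :
    (∀ x : Fin n → ℝ,
      (∀ z : Fin n → ℝ, dualPotential n K μ ν x y ≤ dualPotential n K μ ν z y) ↔
        (∀ i, rowMarginal n K x y i = μ i)) ∧
    (∀ x : Fin n → ℝ,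
      ∀ i, rowMarginal n K
        (fun i' => x i' + Real.log (μ i' / rowMarginal n K x y i')) y i = μ i) := by
  refine ⟨fun x => ⟨fun hmin i => ?_, fun hρ z => ?_⟩, fun x i => ?_⟩
  · have h := hmin fun k => x k + Real.log (μ k / rowMarginal n K x y k)
    rw [dualPotential_add hn hK] at h
    simp only [rowMarginal_mul_exp_log hn hK hμpos, hμsum, Real.log_one] at h
    exact (congrFun (eq_of_sum_mul_log_div_nonpos hμpos (rowMarginal_pos hn hK x y)
      (hμsum.trans (sum_rowMarginal hn hK x y).symm) (by linarith)) i).symm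
  · have h := dualPotential_add hn hK μ ν x (fun k => z k - x k) y
    simp only [add_sub_cancel, hρ] at h
    have := sum_mul_le_log_sum_mul_exp (fun i => (hμpos i).le) hμsum fun k => z k - x k
    linarith
  · rw [rowMarginal_add hn hK]
    simp only [rowMarginal_mul_exp_log hn hK hμpos, hμsum, div_one]
end

section
/- Let n ≥ 1, let K ∈ ℝ^{n×n} have all entries strictly positive, let μ ∈ Δ_n have all entries strictly positive, let ν ∈ Δ_n, and define Φ(x,y) = log(Σ_{ij} K_ij e^{x_i + y_j}) - Σ_i μ_i x_i - Σ_j ν_j y_j. Fix x, y ∈ ℝ^n, let p_ij = K_ij e^{x_i + y_j} / Σ_{kl} K_kl e^{x_k + y_l}, let ρ_i = Σ_j p_ij be the row marginal of p, and let x' be the Sinkhorn row update x'_i = x_i + log(μ_i / ρ_i). Then Φ(x,y) - Φ(x',y) = KL(μ ‖ ρ) := Σ_i μ_i log(μ_i / ρ_i). That is, each Sinkhorn row update decreases the dual potential by exactly the Kullback–Leibler divergence between the target marginal μ and the current row marginal ρ. -/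
/-- The Sinkhorn row update leaves the total mass of the scaled matrix unchanged. -/
theorem sum_exp_row_update
    (n : ℕ) (hn : 1 ≤ n) (K : Matrix (Fin n) (Fin n) ℝ)
    (hK : ∀ i j, 0 < K i j) (μ : Fin n → ℝ)
    (hμpos : ∀ i, 0 < μ i) (hμsum : ∑ i, μ i = 1) (x y : Fin n → ℝ) :
    ∑ i, ∑ j, K i j * Real.exp (x i + Real.log (μ i / rowMarginal n K x y i) + y j)
      = ∑ i, ∑ j, K i j * Real.exp (x i + y j) := by
  have : Nonempty (Fin n) := ⟨⟨0, hn⟩⟩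
  have hrow : ∀ i, 0 < ∑ j, K i j * Real.exp (x i + y j) := fun i =>
    Finset.sum_pos (fun j _ => mul_pos (hK i j) (Real.exp_pos _)) Finset.univ_nonempty
  have htotal : 0 < ∑ i, ∑ j, K i j * Real.exp (x i + y j) :=
    Finset.sum_pos (fun i _ => hrow i) Finset.univ_nonempty
  have hmarginal : ∀ i, 0 < rowMarginal n K x y i := fun i => div_pos (hrow i) htotal
  have hupdate : ∀ i,
      ∑ j, K i j * Real.exp (x i + Real.log (μ i / rowMarginal n K x y i) + y j)
        = μ i * ∑ k, ∑ l, K k l * Real.exp (x k + y l) := by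
    intro i
    calc ∑ j, K i j * Real.exp (x i + Real.log (μ i / rowMarginal n K x y i) + y j)
        = μ i / rowMarginal n K x y i * ∑ j, K i j * Real.exp (x i + y j) := by
          rw [Finset.mul_sum]
          refine Finset.sum_congr rfl fun j _ => ?_
          rw [add_right_comm, Real.exp_add, Real.exp_log (div_pos (hμpos i) (hmarginal i))]
          ring
      _ = μ i * ∑ k, ∑ l, K k l * Real.exp (x k + y l) := by
          have hr := (hrow i).ne'
          have ht := htotal.ne'
          rw [rowMarginal]
          field_simp
  rw [Finset.sum_congr rfl fun i _ => hupdate i, ← Finset.sum_mul, hμsum, one_mul]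

/-- **Per-iteration progress of the Sinkhorn row update.** The Sinkhorn row update
`x' i = x i + log (μ i / ρ i)` decreases the dual potential by exactly the
Kullback–Leibler divergence `KL(μ ‖ ρ) = ∑ i μ i log (μ i / ρ i)` between the target
marginal `μ` and the current row marginal `ρ`. -/
theorem sinkhorn_row_update_progress
    (n : ℕ) (hn : 1 ≤ n) (K : Matrix (Fin n) (Fin n) ℝ)
    (hK : ∀ i j, 0 < K i j) (μ : Fin n → ℝ)
    (hμpos : ∀ i, 0 < μ i) (hμsum : ∑ i, μ i = 1)
    (ν : Fin n → ℝ) (hνpos : ∀ j, 0 ≤ ν j) (hνsum : ∑ j, ν j = 1)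
    (x y : Fin n → ℝ) :
    dualPotential n K μ ν x y
      - dualPotential n K μ ν
          (fun i => x i + Real.log (μ i / rowMarginal n K x y i)) y
      = ∑ i, μ i * Real.log (μ i / rowMarginal n K x y i) := by
  unfold dualPotential
  rw [sum_exp_row_update n hn K hK μ hμpos hμsum x y]
  simp only [mul_add, Finset.sum_add_distrib]
  ring
end

section
/- Let n ≥ 1, let K ∈ ℝ^{n×n} have nonnegative entries, and define Ψ(x) = log(Σ_{ij} K_ij e^{x_i - x_j}) for x ∈ ℝ^n. Fix x ∈ ℝ^n and an index k ∈ [n], and suppose the off-diagonal row sum r_k = Σ_{j ≠ k} K_kj e^{x_k - x_j} and off-diagonal column sum c_k = Σ_{j ≠ k} K_jk e^{x_j - x_k} are both strictly positive. Then the function t ↦ Ψ(x + t e_k) is strictly convex and is minimized at the unique t* = (1/2) log(c_k / r_k); equivalently, x + t e_k minimizes Ψ over changes of coordinate k if and only if the updated matrix has equal k-th off-diagonal row and column sums. (Thus the Osborne update x_k ← x_k + (1/2) log(c_k / r_k) is an exact coordinate descent step on the dual potential.) -/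
/-- The dual potential `Ψ(x) = log ∑_{ij} K_ij e^{x_i - x_j}` for Matrix Balancing. -/
noncomputable def balancePotential (n : ℕ) (K : Matrix (Fin n) (Fin n) ℝ)
    (x : Fin n → ℝ) : ℝ :=
  Real.log (∑ i, ∑ j, K i j * Real.exp (x i - x j))

/-- The `k`-th off-diagonal row sum `r_k = ∑_{j ≠ k} K_kj e^{x_k - x_j}`. -/
noncomputable def offRowSum (n : ℕ) (K : Matrix (Fin n) (Fin n) ℝ)
    (x : Fin n → ℝ) (k : Fin n) : ℝ :=
  ∑ j ∈ Finset.univ.filter (fun j => j ≠ k), K k j * Real.exp (x k - x j)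

/-- The `k`-th off-diagonal column sum `c_k = ∑_{j ≠ k} K_jk e^{x_j - x_k}`. -/
noncomputable def offColSum (n : ℕ) (K : Matrix (Fin n) (Fin n) ℝ)
    (x : Fin n → ℝ) (k : Fin n) : ℝ :=
  ∑ j ∈ Finset.univ.filter (fun j => j ≠ k), K j k * Real.exp (x j - x k)

/-- Splitting a double sum along row `k` and column `k`. -/
lemma sum_sum_eq_row_add_col {ι M : Type*} [Fintype ι] [DecidableEq ι] [AddCommMonoid M]
    (f : ι → ι → M) (k : ι) :
    ∑ i, ∑ j, f i j = (f k k + ∑ i ∈ Finset.univ.erase k, ∑ j ∈ Finset.univ.erase k, f i j) +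
      (∑ j ∈ Finset.univ.erase k, f k j + ∑ j ∈ Finset.univ.erase k, f j k) := by
  have split (g : ι → M) : ∑ i, g i = g k + ∑ i ∈ Finset.univ.erase k, g i :=
    (Finset.add_sum_erase _ g (Finset.mem_univ k)).symm
  simp only [split, Finset.sum_add_distrib]
  abel

lemma offRowSum_add_smul_single (n : ℕ) (K : Matrix (Fin n) (Fin n) ℝ) (x : Fin n → ℝ)
    (k : Fin n) (t : ℝ) :
    offRowSum n K (x + t • (Pi.single k 1 : Fin n → ℝ)) k =
      Real.exp t * offRowSum n K x k := by
  simp only [offRowSum, Finset.mul_sum]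
  refine Finset.sum_congr rfl fun j hj => ?_
  have hjk : j ≠ k := by simpa using hj
  simp only [Pi.add_apply, Pi.smul_apply, Pi.single_eq_same, Pi.single_eq_of_ne hjk, smul_eq_mul]
  rw [mul_left_comm, ← Real.exp_add]
  ring_nf

lemma offColSum_add_smul_single (n : ℕ) (K : Matrix (Fin n) (Fin n) ℝ) (x : Fin n → ℝ)
    (k : Fin n) (t : ℝ) :
    offColSum n K (x + t • (Pi.single k 1 : Fin n → ℝ)) k =
      Real.exp (-t) * offColSum n K x k := by
  simp only [offColSum, Finset.mul_sum]
  refine Finset.sum_congr rfl fun j hj => ?_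
  have hjk : j ≠ k := by simpa using hj
  simp only [Pi.add_apply, Pi.smul_apply, Pi.single_eq_same, Pi.single_eq_of_ne hjk, smul_eq_mul]
  rw [mul_left_comm, ← Real.exp_add]
  ring_nf

/-- Along coordinate `k`, the potential is the logarithm of `A + r_k e^t + c_k e^{-t}`, where
`A` collects the entries that are not affected by the rescaling. -/
lemma exists_balancePotential_add_smul_single_eq (n : ℕ) (K : Matrix (Fin n) (Fin n) ℝ)
    (hK : ∀ i j, 0 ≤ K i j) (x : Fin n → ℝ) (k : Fin n) :
    ∃ A : ℝ, 0 ≤ A ∧ ∀ t : ℝ,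
      balancePotential n K (x + t • (Pi.single k 1 : Fin n → ℝ)) =
        Real.log (A + (Real.exp t * offRowSum n K x k + Real.exp (-t) * offColSum n K x k)) := by
  refine ⟨K k k + ∑ i ∈ Finset.univ.erase k, ∑ j ∈ Finset.univ.erase k,
    K i j * Real.exp (x i - x j), ?_, fun t => ?_⟩
  · exact add_nonneg (hK k k) (Finset.sum_nonneg fun i _ => Finset.sum_nonneg fun j _ =>
      mul_nonneg (hK i j) (Real.exp_pos _).le)
  · rw [balancePotential, sum_sum_eq_row_add_col _ k, ← offRowSum_add_smul_single,
      ← offColSum_add_smul_single, offRowSum, offColSum, Finset.filter_ne']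
    congr 3
    · simp
    · refine Finset.sum_congr rfl fun i hi => Finset.sum_congr rfl fun j hj => ?_
      simp [Pi.single_eq_of_ne (Finset.ne_of_mem_erase hi),
        Pi.single_eq_of_ne (Finset.ne_of_mem_erase hj)]

lemma strictConvexOn_log_add_exp {A r c : ℝ} (hA : 0 ≤ A) (hr : 0 < r) (hc : 0 < c) :
    StrictConvexOn ℝ Set.univ
      (fun t : ℝ => Real.log (A + (Real.exp t * r + Real.exp (-t) * c))) := by
  have pos (t : ℝ) : 0 < A + (Real.exp t * r + Real.exp (-t) * c) := by positivity
  have hexp (t : ℝ) : HasDerivAt (fun t => Real.exp t * r) (Real.exp t * r) t :=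
    (Real.hasDerivAt_exp t).mul_const r
  have hexp_neg (t : ℝ) : HasDerivAt (fun t => Real.exp (-t) * c) (-(Real.exp (-t) * c)) t := by
    simpa using (hasDerivAt_neg t).exp.mul_const c
  have hsum (t : ℝ) : HasDerivAt (fun t => A + (Real.exp t * r + Real.exp (-t) * c))
      (Real.exp t * r - Real.exp (-t) * c) t := by
    simpa [sub_eq_add_neg] using ((hexp t).add (hexp_neg t)).const_add A
  have hlog (t : ℝ) := (hsum t).log (pos t).ne'
  refine strictConvexOn_univ_of_deriv2_pos
    (continuous_iff_continuousAt.2 fun t => (hlog t).continuousAt) fun t => ?_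
  rw [Function.iterate_succ, Function.iterate_one, Function.comp_apply,
    funext fun s => (hlog s).deriv]
  have hquot := ((hexp t).sub (hexp_neg t)).div (hsum t) (pos t).ne'
  have hp : 0 < Real.exp t * r := by positivity
  have hq : 0 < Real.exp (-t) * c := by positivity
  refine lt_of_lt_of_eq (div_pos ?_ (pow_pos (pos t) 2)) hquot.deriv.symm
  simp only [Pi.sub_apply]
  nlinarith [mul_pos hp hq, mul_nonneg hA hp.le, mul_nonneg hA hq.le]

/-- The rescaled sums `r e^t` and `c e^{-t}`, centred at `t = (1/2) log (c / r)`. -/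
lemma exp_mul_add_exp_neg_mul_eq_cosh {r c : ℝ} (hr : 0 < r) (hc : 0 < c) (t : ℝ) :
    Real.exp t * r + Real.exp (-t) * c =
      2 * Real.exp ((Real.log r + Real.log c) / 2) *
        Real.cosh (t - (1 / 2) * Real.log (c / r)) := by
  have hrow : Real.exp t * r = Real.exp ((Real.log r + Real.log c) / 2) *
      Real.exp (t - (1 / 2) * Real.log (c / r)) := by
    conv_lhs => rw [← Real.exp_log hr]
    rw [Real.log_div hc.ne' hr.ne', ← Real.exp_add, ← Real.exp_add]
    ring_nf
  have hcol : Real.exp (-t) * c = Real.exp ((Real.log r + Real.log c) / 2) *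
      Real.exp (-(t - (1 / 2) * Real.log (c / r))) := by
    conv_lhs => rw [← Real.exp_log hc]
    rw [Real.log_div hc.ne' hr.ne', ← Real.exp_add, ← Real.exp_add]
    ring_nf
  rw [hrow, hcol, Real.cosh_eq]
  ring

lemma exp_mul_eq_exp_neg_mul_iff {r c : ℝ} (hr : 0 < r) (hc : 0 < c) (t : ℝ) :
    Real.exp t * r = Real.exp (-t) * c ↔ t = (1 / 2) * Real.log (c / r) := by
  rw [← Real.log_injOn_pos.eq_iff (Set.mem_Ioi.2 (by positivity))
    (Set.mem_Ioi.2 (by positivity)), Real.log_mul (Real.exp_pos _).ne' hr.ne',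
    Real.log_mul (Real.exp_pos _).ne' hc.ne', Real.log_exp, Real.log_exp,
    Real.log_div hc.ne' hr.ne']
  constructor <;> intro h <;> linarith

lemma log_add_exp_le_iff {A r c : ℝ} (hA : 0 ≤ A) (hr : 0 < r) (hc : 0 < c) (s t : ℝ) :
    Real.log (A + (Real.exp s * r + Real.exp (-s) * c)) ≤
        Real.log (A + (Real.exp t * r + Real.exp (-t) * c)) ↔
      |s - (1 / 2) * Real.log (c / r)| ≤ |t - (1 / 2) * Real.log (c / r)| := by
  rw [Real.log_le_log_iff (by positivity) (by positivity), add_le_add_iff_left,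
    exp_mul_add_exp_neg_mul_eq_cosh hr hc, exp_mul_add_exp_neg_mul_eq_cosh hr hc,
    mul_le_mul_iff_right₀ (by positivity), Real.cosh_le_cosh]

/-- **The Osborne update is exact coordinate descent.** Fix `x` and a coordinate `k` with
strictly positive off-diagonal row sum `r_k` and column sum `c_k`. Then `t ↦ Ψ(x + t e_k)`
is strictly convex and is minimized at the unique `t* = (1/2) log (c_k / r_k)`;
equivalently, `x + t e_k` minimizes `Ψ` over changes of coordinate `k` iff the updated
matrix has equal `k`-th off-diagonal row and column sums. -/
theorem osborne_update_coordinate_descent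
    (n : ℕ) (hn : 1 ≤ n) (K : Matrix (Fin n) (Fin n) ℝ)
    (hK : ∀ i j, 0 ≤ K i j) (x : Fin n → ℝ) (k : Fin n)
    (hr : 0 < offRowSum n K x k) (hc : 0 < offColSum n K x k) :
    StrictConvexOn ℝ Set.univ
      (fun t : ℝ => balancePotential n K (x + t • (Pi.single k 1 : Fin n → ℝ))) ∧
    (∀ t : ℝ,
      balancePotential n K (x + ((1 / 2) * Real.log (offColSum n K x k / offRowSum n K x k)) • (Pi.single k 1 : Fin n → ℝ))
        ≤ balancePotential n K (x + t • (Pi.single k 1 : Fin n → ℝ))) ∧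
    (∀ t : ℝ,
      (∀ s : ℝ, balancePotential n K (x + t • (Pi.single k 1 : Fin n → ℝ))
          ≤ balancePotential n K (x + s • (Pi.single k 1 : Fin n → ℝ))) →
        t = (1 / 2) * Real.log (offColSum n K x k / offRowSum n K x k)) ∧
    (∀ t : ℝ,
      (∀ s : ℝ, balancePotential n K (x + t • (Pi.single k 1 : Fin n → ℝ))
          ≤ balancePotential n K (x + s • (Pi.single k 1 : Fin n → ℝ))) ↔
        offRowSum n K (x + t • (Pi.single k 1 : Fin n → ℝ)) k
          = offColSum n K (x + t • (Pi.single k 1 : Fin n → ℝ)) k) := by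
  obtain ⟨A, hA, hΨ⟩ := exists_balancePotential_add_smul_single_eq n K hK x k
  simp only [hΨ, offRowSum_add_smul_single, offColSum_add_smul_single,
    exp_mul_eq_exp_neg_mul_iff hr hc, log_add_exp_le_iff hA hr hc]
  have huniq (t : ℝ) (h : ∀ s : ℝ,
      |t - (1 / 2) * Real.log (offColSum n K x k / offRowSum n K x k)| ≤
        |s - (1 / 2) * Real.log (offColSum n K x k / offRowSum n K x k)|) :
      t = (1 / 2) * Real.log (offColSum n K x k / offRowSum n K x k) := by
    simpa [sub_eq_zero] using h ((1 / 2) * Real.log (offColSum n K x k / offRowSum n K x k))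
  refine ⟨strictConvexOn_log_add_exp hA hr hc, fun t => by simp, huniq,
    fun t => ⟨huniq t, ?_⟩⟩
  rintro rfl s
  simp
end

section
/- Let n ≥ 1, let K ∈ ℝ^{n×n} have nonnegative entries, and define Ψ(x) = log(Σ_{ij} K_ij e^{x_i - x_j}) for x ∈ ℝ^n. Fix x ∈ ℝ^n with S = Σ_{ij} K_ij e^{x_i - x_j} > 0 and an index k ∈ [n] such that r_k = Σ_{j ≠ k} K_kj e^{x_k - x_j} > 0 and c_k = Σ_{j ≠ k} K_jk e^{x_j - x_k} > 0. Let x' = x + (1/2) log(c_k / r_k) · e_k be the Osborne update at coordinate k. Then Ψ(x) - Ψ(x') = -log(1 - (√r_k - √c_k)² / S), and in particular Ψ(x) - Ψ(x') ≥ (√r_k - √c_k)² / S; i.e., each Osborne update decreases the dual potential by an amount controlled by the (Hellinger-type) imbalance (√r_k - √c_k)² between the k-th row and column sums. -/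
/-- The total sum `S = ∑_{ij} K_ij e^{x_i - x_j}`. -/
noncomputable def totalSum (n : ℕ) (K : Matrix (Fin n) (Fin n) ℝ)
    (x : Fin n → ℝ) : ℝ :=
  ∑ i, ∑ j, K i j * Real.exp (x i - x j)

open Finset in
/-- The total sum splits into a diagonal entry, its off-diagonal row and column, and the rest. -/
theorem totalSum_eq_add (n : ℕ) (K : Matrix (Fin n) (Fin n) ℝ) (x : Fin n → ℝ) (k : Fin n) :
    totalSum n K x = K k k + offRowSum n K x k + offColSum n K x k +
      ∑ i ∈ univ.erase k, ∑ j ∈ univ.erase k, K i j * Real.exp (x i - x j) := by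
  have split (f : Fin n → ℝ) : ∑ i, f i = f k + ∑ i ∈ univ.erase k, f i :=
    (add_sum_erase univ f (mem_univ k)).symm
  simp only [totalSum, offRowSum, offColSum, filter_ne']
  rw [split]
  simp only [split (fun j => K _ j * _), sum_add_distrib, sub_self, Real.exp_zero, mul_one]
  ring

theorem offRowSum_add_single (n : ℕ) (K : Matrix (Fin n) (Fin n) ℝ) (x : Fin n → ℝ)
    (k : Fin n) (t : ℝ) :
    offRowSum n K (x + t • Pi.single k 1) k = Real.exp t * offRowSum n K x k := by
  simp only [offRowSum, Finset.mul_sum]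
  refine Finset.sum_congr rfl fun j hj => ?_
  have hjk : j ≠ k := (Finset.mem_filter.1 hj).2
  simp only [Pi.add_apply, Pi.smul_apply, Pi.single_eq_same, Pi.single_eq_of_ne hjk, smul_eq_mul,
    mul_one, mul_zero, add_zero]
  rw [mul_left_comm, ← Real.exp_add]
  ring_nf

theorem offColSum_add_single (n : ℕ) (K : Matrix (Fin n) (Fin n) ℝ) (x : Fin n → ℝ)
    (k : Fin n) (t : ℝ) :
    offColSum n K (x + t • Pi.single k 1) k = Real.exp (-t) * offColSum n K x k := by
  simp only [offColSum, Finset.mul_sum]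
  refine Finset.sum_congr rfl fun j hj => ?_
  have hjk : j ≠ k := (Finset.mem_filter.1 hj).2
  simp only [Pi.add_apply, Pi.smul_apply, Pi.single_eq_same, Pi.single_eq_of_ne hjk, smul_eq_mul,
    mul_one, mul_zero, add_zero]
  rw [mul_left_comm, ← Real.exp_add]
  ring_nf

/-- Effect on the total sum of shifting one coordinate. -/
theorem totalSum_add_single (n : ℕ) (K : Matrix (Fin n) (Fin n) ℝ) (x : Fin n → ℝ)
    (k : Fin n) (t : ℝ) :
    totalSum n K (x + t • Pi.single k 1) = totalSum n K x +
      (Real.exp t - 1) * offRowSum n K x k + (Real.exp (-t) - 1) * offColSum n K x k := by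
  rw [totalSum_eq_add n K _ k, totalSum_eq_add n K x k, offRowSum_add_single,
    offColSum_add_single]
  have rest : ∑ i ∈ Finset.univ.erase k, ∑ j ∈ Finset.univ.erase k,
      K i j * Real.exp ((x + t • Pi.single k 1 : Fin n → ℝ) i -
        (x + t • Pi.single k 1 : Fin n → ℝ) j) =
      ∑ i ∈ Finset.univ.erase k, ∑ j ∈ Finset.univ.erase k, K i j * Real.exp (x i - x j) := by
    refine Finset.sum_congr rfl fun i hi => Finset.sum_congr rfl fun j hj => ?_
    simp [Pi.single_eq_of_ne (Finset.ne_of_mem_erase hi),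
      Pi.single_eq_of_ne (Finset.ne_of_mem_erase hj)]
  rw [rest]
  ring

theorem offRowSum_le_totalSum (n : ℕ) (K : Matrix (Fin n) (Fin n) ℝ) (hK : ∀ i j, 0 ≤ K i j)
    (x : Fin n → ℝ) (k : Fin n) : offRowSum n K x k ≤ totalSum n K x := by
  have hcol : 0 ≤ offColSum n K x k :=
    Finset.sum_nonneg fun j _ => mul_nonneg (hK j k) (Real.exp_pos _).le
  have hrest : 0 ≤ ∑ i ∈ Finset.univ.erase k, ∑ j ∈ Finset.univ.erase k,
      K i j * Real.exp (x i - x j) :=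
    Finset.sum_nonneg fun i _ => Finset.sum_nonneg fun j _ =>
      mul_nonneg (hK i j) (Real.exp_pos _).le
  linarith [totalSum_eq_add n K x k, hK k k]

theorem exp_half_log_div {a b : ℝ} (ha : 0 < a) (hb : 0 < b) :
    Real.exp ((1 / 2) * Real.log (a / b)) = √a / √b := by
  rw [← Real.sqrt_div ha.le, Real.sqrt_eq_rpow, Real.rpow_def_of_pos (div_pos ha hb), mul_comm]

/-- The total sum after an Osborne update. -/
theorem totalSum_osborne (n : ℕ) (K : Matrix (Fin n) (Fin n) ℝ) (x : Fin n → ℝ) (k : Fin n)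
    (hr : 0 < offRowSum n K x k) (hc : 0 < offColSum n K x k) :
    totalSum n K (x + ((1 / 2) * Real.log (offColSum n K x k / offRowSum n K x k)) •
        Pi.single k 1) =
      totalSum n K x - (√(offRowSum n K x k) - √(offColSum n K x k)) ^ 2 := by
  rw [totalSum_add_single, Real.exp_neg, exp_half_log_div hc hr]
  have hr' := Real.sqrt_pos.2 hr
  have hc' := Real.sqrt_pos.2 hc
  have hrow : √(offColSum n K x k) / √(offRowSum n K x k) * offRowSum n K x k =
      √(offColSum n K x k) * √(offRowSum n K x k) := by
    rw [div_mul_eq_mul_div, mul_div_assoc, Real.div_sqrt]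
  have hcol : (√(offColSum n K x k) / √(offRowSum n K x k))⁻¹ * offColSum n K x k =
      √(offColSum n K x k) * √(offRowSum n K x k) := by
    rw [inv_div, div_mul_eq_mul_div, mul_div_assoc, Real.div_sqrt, mul_comm]
  linear_combination hrow + hcol + Real.sq_sqrt hr.le + Real.sq_sqrt hc.le

/-- **Per-iteration progress of the Osborne update.** The Osborne update
`x' = x + (1/2) log (c_k / r_k) e_k` decreases the dual potential by exactly
`-log (1 - (√r_k - √c_k)² / S)`, and in particular by at least `(√r_k - √c_k)² / S`. -/
theorem osborne_update_progress
    (n : ℕ) (hn : 1 ≤ n) (K : Matrix (Fin n) (Fin n) ℝ)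
    (hK : ∀ i j, 0 ≤ K i j) (x : Fin n → ℝ) (k : Fin n)
    (hS : 0 < totalSum n K x)
    (hr : 0 < offRowSum n K x k) (hc : 0 < offColSum n K x k) :
    balancePotential n K x
        - balancePotential n K
            (x + ((1 / 2) * Real.log (offColSum n K x k / offRowSum n K x k)) •
              (Pi.single k 1 : Fin n → ℝ))
      = -Real.log (1 -
          (Real.sqrt (offRowSum n K x k) - Real.sqrt (offColSum n K x k)) ^ 2
            / totalSum n K x) ∧
    balancePotential n K x
        - balancePotential n K
            (x + ((1 / 2) * Real.log (offColSum n K x k / offRowSum n K x k)) •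
              (Pi.single k 1 : Fin n → ℝ))
      ≥ (Real.sqrt (offRowSum n K x k) - Real.sqrt (offColSum n K x k)) ^ 2
          / totalSum n K x := by
  set x' : Fin n → ℝ :=
    x + ((1 / 2) * Real.log (offColSum n K x k / offRowSum n K x k)) • Pi.single k 1 with hx'
  have htotal : totalSum n K x' =
      totalSum n K x - (√(offRowSum n K x k) - √(offColSum n K x k)) ^ 2 :=
    totalSum_osborne n K x k hr hc
  have hpos : 0 < totalSum n K x' := by
    refine lt_of_lt_of_le ?_ (offRowSum_le_totalSum n K hK x' k)
    rw [hx', offRowSum_add_single]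
    exact mul_pos (Real.exp_pos _) hr
  have hratio : 1 - (√(offRowSum n K x k) - √(offColSum n K x k)) ^ 2 / totalSum n K x =
      totalSum n K x' / totalSum n K x := by
    rw [htotal, sub_div, div_self hS.ne']
  have heq : balancePotential n K x - balancePotential n K x' = -Real.log (1 -
      (√(offRowSum n K x k) - √(offColSum n K x k)) ^ 2 / totalSum n K x) := by
    rw [hratio, Real.log_div hpos.ne' hS.ne', neg_sub]
    rfl
  refine ⟨heq, ?_⟩
  have hlog := Real.log_le_sub_one_of_pos (hratio ▸ div_pos hpos hS)
  linarith
end
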